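/- arXiv:1809.09471 — 6 statements merged into one kernel-verified Lean document; each statement's English description precedes it below -/
import Mathlib

section
/- For every d ≥ 1 and every 0 < l ≤ 1 there exists a polynomial p_{d,l} of degree d such that for every d-dimensional polytope P ⊆ ℝ^d with l·B̄(0,1) ⊆ P ⊆ B̄(0,1) (B̄(0,1) the closed Euclidean unit ball), one has Vol^H_{int P}(B_{int P}(0,R)) ≤ p_{d,l}(R) · |Flags(P)| for all R ≥ 0, and likewise Vol^H_{int P}(AsB_{int P}(0,R)) ≤ p_{d,l}(R) · |Flags(P)| for all R ≥ 0. -/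
open Filter Set MeasureTheory Metric
open scoped ENNReal Topology Pointwise RealInnerProductSpace

noncomputable section
open scoped Classical

abbrev Euc (d : ℕ) := EuclideanSpace ℝ (Fin d)

/-- The Hilbert distance on a bounded open convex set `U`. -/
def hilbertDist {d : ℕ} (U : Set (Euc d)) (p q : Euc d) : ℝ :=
  if p = q then 0
  else
    (1 / 2) * Real.log
      (((1 - sInf {t : ℝ | p + t • (q - p) ∈ U}) / (- sInf {t : ℝ | p + t • (q - p) ∈ U})) *
        (sSup {t : ℝ | p + t • (q - p) ∈ U} / (sSup {t : ℝ | p + t • (q - p) ∈ U} - 1)))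

/-- The closed Hilbert ball. -/
def hilbertBall {d : ℕ} (U : Set (Euc d)) (p : Euc d) (R : ℝ) : Set (Euc d) :=
  {q ∈ U | hilbertDist U p q ≤ R}

/-- The Finsler (Hilbert) norm `F_U(p, v)`. -/
def finslerNorm {d : ℕ} (U : Set (Euc d)) (p v : Euc d) : ℝ :=
  if v = 0 then 0
  else (1 / 2) * (1 / sSup {t : ℝ | 0 < t ∧ p + t • v ∈ U}
                + 1 / sSup {t : ℝ | 0 < t ∧ p - t • v ∈ U})

/-- The unit ball `β_U(p)` of the Finsler norm. -/
def finslerUnitBall {d : ℕ} (U : Set (Euc d)) (p : Euc d) : Set (Euc d) :=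
  {v | finslerNorm U p v < 1}

/-- The Busemann volume of `A ⊆ U`. -/
def busemannVol {d : ℕ} (U : Set (Euc d)) (A : Set (Euc d)) : ℝ≥0∞ :=
  ∫⁻ p in A, volume (Metric.ball (0 : Euc d) 1) / volume (finslerUnitBall U p)

/-- The polar body `K°`. -/
def polarSet {d : ℕ} (K : Set (Euc d)) : Set (Euc d) :=
  {y | ∀ v ∈ K, ⟪v, y⟫ ≤ (1 : ℝ)}

/-- The Holmes–Thompson volume of `A ⊆ U`. -/
def htVol {d : ℕ} (U : Set (Euc d)) (A : Set (Euc d)) : ℝ≥0∞ :=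
  ∫⁻ p in A, volume (polarSet (finslerUnitBall U p)) / volume (Metric.ball (0 : Euc d) 1)

/-- The asymptotic ball `AsB_U(y, R)`. -/
def asympBall {d : ℕ} (U : Set (Euc d)) (y : Euc d) (R : ℝ) : Set (Euc d) :=
  if 0 < R then (fun u => y + (1 - Real.exp (-2 * R)) • (u - y)) '' U else ∅

/-- `F` is a face of the compact convex set `P`. -/
def IsFace {d : ℕ} (P F : Set (Euc d)) : Prop :=
  F.Nonempty ∧ IsClosed F ∧ Convex ℝ F ∧ IsExtreme ℝ P F

/-- The dimension of a set: the dimension of its affine span. -/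
def faceDim {d : ℕ} (F : Set (Euc d)) : ℕ :=
  Module.finrank ℝ (affineSpan ℝ F).direction

/-- The set of maximal flags of a `dm`-dimensional polytope `P ⊆ ℝ^d`. -/
def flagSet {d : ℕ} (dm : ℕ) (P : Set (Euc d)) : Set (Fin (dm + 1) → Set (Euc d)) :=
  {f | (∀ i, IsFace P (f i) ∧ faceDim (f i) = (i : ℕ)) ∧
       ∀ i j : Fin (dm + 1), i ≤ j → f i ⊆ f j}

/-- `N(ε, Ω)`: the least number of maximal flags of a `d`-dimensional polytope within
Hausdorff distance `ε` of `Ω`. -/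
def flagNumber (d : ℕ) (Ω : Set (Euc d)) (ε : ℝ) : ℕ :=
  sInf {n | ∃ V : Finset (Euc d), V.Nonempty ∧
    faceDim (convexHull ℝ (V : Set (Euc d))) = d ∧
    Metric.hausdorffDist (convexHull ℝ (V : Set (Euc d))) Ω ≤ ε ∧
    (flagSet d (convexHull ℝ (V : Set (Euc d)))).ncard = n}

/-- The flag approximability `a_f(Ω)`. -/
def flagApprox (d : ℕ) (Ω : Set (Euc d)) : ℝ :=
  liminf (fun ε : ℝ => Real.log (flagNumber d Ω ε) / (- Real.log ε)) (𝓝[>] 0)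

/-- `s` is a `dm`-simplex. -/
def IsSimplexSet {d : ℕ} (dm : ℕ) (s : Set (Euc d)) : Prop :=
  ∃ v : Fin (dm + 1) → Euc d, AffineIndependent ℝ v ∧ s = convexHull ℝ (Set.range v)

/-- `S` is a flag simplex of the `dm`-dimensional polytope `P`. -/
def IsFlagSimplex {d : ℕ} (dm : ℕ) (P S : Set (Euc d)) : Prop :=
  ∃ f ∈ flagSet dm P, ∃ v : Fin (dm + 1) → Euc d, AffineIndependent ℝ v ∧
    S = convexHull ℝ (Set.range v) ∧ ∀ i, v i ∈ intrinsicInterior ℝ (f i)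

/-- The Macbeath region `M'(x)`. -/
def macbeath {d : ℕ} (Ω : Set (Euc d)) (x : Euc d) : Set (Euc d) :=
  (fun v => x + v) ''
    (((5 : ℝ)⁻¹ • ((fun w => w - x) '' Ω)) ∩ ((5 : ℝ)⁻¹ • ((fun w => x - w) '' Ω)))

/-- The Funk distance with respect to the convex body `Ω`. -/
def funkDist {d : ℕ} (Ω : Set (Euc d)) (p q : Euc d) : ℝ :=
  if p = q then 0
  else Real.log (sSup {t : ℝ | p + t • (q - p) ∈ Ω} /
        (sSup {t : ℝ | p + t • (q - p) ∈ Ω} - 1))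

/-! ### Faces of polytopes -/

lemma face_eq_hull {d : ℕ} {W : Set (Euc d)} {F : Set (Euc d)}
    (hF : IsExtreme ℝ (convexHull ℝ W) F) (hc : Convex ℝ F) :
    F = convexHull ℝ (F ∩ W) := by
  apply Subset.antisymm
  · intro x hx
    have hxP := hF.subset hx
    have hdc : Convex ℝ (convexHull ℝ W \ F) := hF.convex_sdiff (convex_convexHull ℝ W)
    have hsub : convexHull ℝ (W \ F) ⊆ convexHull ℝ W \ F :=
      convexHull_min (fun y hy => ⟨subset_convexHull ℝ W hy.1, hy.2⟩) hdc
    rcases (W \ F).eq_empty_or_nonempty with h1 | h1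
    · have : F ∩ W = W := by
        rw [inter_eq_right]; exact sdiff_eq_empty.1 h1
      rw [this]; exact hxP
    rcases (F ∩ W).eq_empty_or_nonempty with h2 | h2
    · have : W \ F = W := by
        ext y
        constructor
        · exact fun h => h.1
        · intro h
          refine ⟨h, fun hy => ?_⟩
          have : y ∈ F ∩ W := ⟨hy, h⟩
          rw [h2] at this
          exact this
      rw [this] at hsub
      exact absurd hx (hsub hxP).2
    have hW : W = (F ∩ W) ∪ (W \ F) := by
      ext y; by_cases hy : y ∈ F <;> simp [hy]
    rw [hW, convexHull_union h2 h1] at hxP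
    obtain ⟨a, ha, b, hb, hxab⟩ := mem_convexJoin.1 hxP
    have hb' := hsub hb
    have ha' : a ∈ convexHull ℝ W := convexHull_mono inter_subset_right ha
    rw [← insert_endpoints_openSegment] at hxab
    rcases hxab with rfl | rfl | hx'
    · exact ha
    · exact absurd hx hb'.2
    · exact absurd (hF.right_mem_of_mem_openSegment ha' hb'.1 hx hx') hb'.2
  · exact convexHull_min inter_subset_left hc

lemma faces_finite {d : ℕ} (W : Finset (Euc d)) :
    {F : Set (Euc d) | IsFace (convexHull ℝ (W : Set (Euc d))) F}.Finite := by
  refine ((W.finite_toSet.finite_subsets).image (fun V => convexHull ℝ V)).subset ?_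
  rintro F ⟨-, -, hc, he⟩
  exact ⟨F ∩ W, inter_subset_right, (face_eq_hull he hc).symm⟩

lemma faceDim_lt {d : ℕ} {F G : Set (Euc d)} (hG0 : G.Nonempty) (hGc : Convex ℝ G)
    (hGF : IsExtreme ℝ F G) (hne : G ≠ F) : faceDim G < faceDim F := by
  have hsub := hGF.subset
  have hle : affineSpan ℝ G ≤ affineSpan ℝ F := affineSpan_mono ℝ hsub
  have hdle := AffineSubspace.direction_le hle
  by_contra hcon
  have heq : (affineSpan ℝ G).direction = (affineSpan ℝ F).direction :=
    Submodule.eq_of_le_of_finrank_le hdle (not_lt.1 hcon)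
  have hspan : affineSpan ℝ G = affineSpan ℝ F :=
    AffineSubspace.eq_of_direction_eq_of_nonempty_of_le heq
      ((affineSpan_nonempty ℝ).2 hG0) hle
  apply hne
  refine Subset.antisymm hsub ?_
  intro x hx
  obtain ⟨y, hy⟩ := Set.Nonempty.intrinsicInterior hGc hG0
  obtain ⟨y', hy', rfl⟩ := mem_intrinsicInterior.1 hy
  have hyG : (y' : Euc d) ∈ G := intrinsicInterior_subset hy
  have hxs : x ∈ affineSpan ℝ G := by rw [hspan]; exact subset_affineSpan ℝ F hx
  have hmem : ∀ t : ℝ, (y' : Euc d) + t • (x - y') ∈ affineSpan ℝ G := by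
    intro t
    have := AffineMap.lineMap_mem (k := ℝ) t y'.2 hxs
    rw [AffineMap.lineMap_apply] at this
    simpa [add_comm] using this
  let φ : ℝ → affineSpan ℝ G := fun t => ⟨(y' : Euc d) + t • (x - y'), hmem t⟩
  have hφv : ∀ t, ((φ t : affineSpan ℝ G) : Euc d) = (y' : Euc d) + t • (x - y') :=
    fun t => rfl
  have hφ : Continuous φ := by
    rw [continuous_induced_rng]
    have : (Subtype.val ∘ φ) = fun t : ℝ => (y' : Euc d) + t • (x - y') := funext hφv
    rw [this]; fun_prop
  have hφ0 : φ 0 = y' := Subtype.ext (by simp [φ])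
  have hev : ∀ᶠ t in 𝓝 (0 : ℝ), φ t ∈ interior ((↑) ⁻¹' G : Set (affineSpan ℝ G)) := by
    apply hφ.continuousAt.eventually_mem
    rw [hφ0]; exact isOpen_interior.mem_nhds hy'
  obtain ⟨ε, hε, hball⟩ := Metric.eventually_nhds_iff.1 hev
  have h1 : φ (-(ε/2)) ∈ interior ((↑) ⁻¹' G : Set (affineSpan ℝ G)) := by
    apply hball (y := -(ε/2))
    rw [Real.dist_eq, sub_zero, abs_neg, abs_of_pos (by positivity)]; linarith
  have h2 : ((φ (-(ε/2)) : affineSpan ℝ G) : Euc d) ∈ G :=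
    (interior_subset h1 : φ (-(ε/2)) ∈ ((↑) ⁻¹' G : Set (affineSpan ℝ G)))
  rw [hφv] at h2
  refine hGF.left_mem_of_mem_openSegment hx (hsub h2) hyG ?_
  refine ⟨(ε/2)/(1+ε/2), 1/(1+ε/2), by positivity, by positivity, by field_simp; ring, ?_⟩
  have : (1 + ε/2) ≠ 0 := by positivity
  rw [smul_add, smul_smul, smul_sub]
  match_scalars <;> field_simp <;> ring

/-- Helly: a compact convex set has a point which is uniformly central. -/
lemma exists_center {d : ℕ} (F : Set (Euc d)) (hne : F.Nonempty) (hcp : IsCompact F)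
    (hc : Convex ℝ F) :
    ∃ c ∈ F, ∀ κ : ℝ, 0 ≤ κ → κ ≤ 1 / (d + 2) → ∀ x ∈ F, ∀ y ∈ F, c + κ • (x - y) ∈ F := by
  have hd : (0 : ℝ) < d + 2 := by positivity
  let a : ℝ := 1 / (d + 2)
  have ha : 0 < a := by positivity
  have ha1 : a ≤ 1 := by
    simp only [a]; rw [div_le_one hd]; have : (0 : ℝ) ≤ d := by positivity
    linarith
  let A : F → Set (Euc d) := fun x => (fun z => a • (x : Euc d) + (1 - a) • z) '' F
  have hA : (⋂ i, A i).Nonempty := by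
    apply Convex.helly_theorem_compact' (𝕜 := ℝ)
    · intro i
      have : A i = (fun w => a • (i : Euc d) + w) '' ((fun z => (1 - a) • z) '' F) := by
        simp only [A]; rw [image_image]
      rw [this]
      exact (hc.smul (1 - a)).translate _
    · intro i
      exact hcp.image (by fun_prop)
    · intro I hI
      have hI' : (I.card : ℝ) ≤ d + 1 := by
        have : I.card ≤ d + 1 := by simpa using hI
        exact_mod_cast this
      obtain ⟨x0, hx0⟩ := hne
      -- the point: sum of a • x over I, plus remaining weight at x0
      refine ⟨∑ i ∈ I, a • (i : Euc d) + (1 - a * I.card) • x0, ?_⟩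
      simp only [mem_iInter]
      intro i hi
      have h1a : 0 < 1 - a := by
        have : a < 1 := by
          simp only [a]; rw [div_lt_one hd]; have : (0 : ℝ) ≤ d := by positivity
          linarith
        linarith
      have hcard : a * I.card ≤ 1 := by
        simp only [a]; rw [one_div, inv_mul_le_iff₀ hd]; linarith
      have hce : ((I.erase i).card : ℝ) = I.card - 1 := by
        rw [Finset.card_erase_of_mem hi, Nat.cast_sub (Finset.card_pos.2 ⟨i, hi⟩)]; simp
      refine ⟨∑ j ∈ I.erase i, (a / (1 - a)) • (j : Euc d) +
        ((1 - a * I.card) / (1 - a)) • x0, ?_, ?_⟩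
      · have := hc.sum_mem (t := (Finset.insertNone (I.erase i)))
          (w := fun o => o.elim ((1 - a * I.card) / (1 - a)) (fun _ => a / (1 - a)))
          (z := fun o => o.elim x0 (fun j : F => (j : Euc d))) ?_ ?_ ?_
        · simpa [Finset.sum_insertNone, add_comm] using this
        · rintro (_ | j) -
          · exact div_nonneg (by linarith) h1a.le
          · exact div_nonneg ha.le h1a.le
        · simp only [Finset.sum_insertNone, Option.elim, Finset.sum_const, nsmul_eq_mul, hce]
          field_simp; ring
        · rintro (_ | j) -
          · exact hx0
          · exact j.2
      · simp only [smul_add, Finset.smul_sum, smul_smul]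
        rw [← Finset.add_sum_erase I _ hi]
        rw [mul_div_cancel₀ _ h1a.ne', mul_div_cancel₀ _ h1a.ne', add_assoc]
  obtain ⟨c, hcA⟩ := hA
  have hcA' : ∀ x ∈ F, ∃ z ∈ F, a • x + (1 - a) • z = c := by
    intro x hx
    have := mem_iInter.1 hcA ⟨x, hx⟩
    exact this
  have hcF : c ∈ F := by
    obtain ⟨x0, hx0⟩ := hne
    obtain ⟨z, hz, rfl⟩ := hcA' x0 hx0
    exact hc hx0 hz ha.le (by linarith) (by ring)
  refine ⟨c, hcF, ?_⟩
  have key : ∀ x ∈ F, ∀ y ∈ F, c + a • (x - y) ∈ F := by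
    intro x hx y hy
    obtain ⟨z, hz, hzc⟩ := hcA' y hy
    have : c + a • (x - y) = a • x + (1 - a) • z := by
      rw [← hzc, smul_sub]; abel
    rw [this]
    exact hc hx hz ha.le (by linarith) (by ring)
  intro κ hκ hκa x hx y hy
  have h := hc hcF (key x hx y hy) (a := 1 - κ / a) (b := κ / a)
    (by rw [sub_nonneg, div_le_one ha]; exact hκa) (by positivity) (by ring)
  convert h using 1
  rw [smul_add, smul_smul, div_mul_cancel₀ _ ha.ne', ← add_assoc, ← add_smul]
  simp

/-- Minimal faces. -/
lemma exists_smaller_face {d : ℕ} (W : Finset (Euc d)) (F : Set (Euc d))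
    (hF : IsFace (convexHull ℝ (W : Set (Euc d))) F) (c p : Euc d) (hcF : c ∈ F) (hp : p ∈ F)
    (hpc : p ≠ c) :
    ∃ G, IsFace (convexHull ℝ (W : Set (Euc d))) G ∧ IsExtreme ℝ F G ∧ G ≠ F ∧
      ∃ q ∈ G, p ∈ segment ℝ c q := by
  obtain ⟨hne, hcl, hcv, hex⟩ := hF
  have hbd : Bornology.IsBounded F :=
    (W.finite_toSet.isCompact_convexHull (𝕜 := ℝ)).isBounded.subset hex.subset
  have hcp : IsCompact F := Metric.isCompact_of_isClosed_isBounded hcl hbd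
  -- exit time
  let T : Set ℝ := {t | c + t • (p - c) ∈ F}
  have hv : 0 < ‖p - c‖ := norm_pos_iff.2 (sub_ne_zero.2 hpc)
  have hTcl : IsClosed T := hcl.preimage (by fun_prop)
  have h1T : (1 : ℝ) ∈ T := by simp [T, hp]
  obtain ⟨M, hM⟩ := hbd.exists_norm_le
  have hTb : BddAbove T := by
    refine ⟨(M + ‖c‖) / ‖p - c‖, fun t ht => ?_⟩
    rw [le_div_iff₀ hv]
    have h1 := hM _ ht
    have h2 : ‖t • (p - c)‖ ≤ ‖c + t • (p - c)‖ + ‖c‖ := by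
      have := norm_sub_le (c + t • (p - c)) c
      simpa using this
    rw [norm_smul] at h2
    have h3 : t * ‖p - c‖ ≤ ‖t‖ * ‖p - c‖ :=
      mul_le_mul_of_nonneg_right (le_abs_self t) hv.le
    linarith
  let t0 := sSup T
  have ht0 : t0 ∈ T := hTcl.csSup_mem ⟨1, h1T⟩ hTb
  have ht1 : 1 ≤ t0 := le_csSup hTb h1T
  have ht0p : 0 < t0 := by linarith
  let q := c + t0 • (p - c)
  have hq : q ∈ F := ht0
  let G : Set (Euc d) := {x | x ∈ F ∧ ∃ ε : ℝ, 0 < ε ∧ q + ε • (q - x) ∈ F}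
  have hqG : q ∈ G := ⟨hq, 1, one_pos, by simpa using hq⟩
  have hcG : c ∉ G := by
    rintro ⟨-, ε, hε, h⟩
    have : t0 + ε * t0 ∈ T := by
      have e : q + ε • (q - c) = c + (t0 + ε * t0) • (p - c) := by
        simp only [q]; rw [add_sub_cancel_left, smul_smul, add_smul, add_assoc]
      rw [e] at h; exact h
    have := le_csSup hTb this
    have h3 : 0 < ε * t0 := by positivity
    change t0 + ε * t0 ≤ t0 at this
    linarith
  have shrink : ∀ (x : Euc d) (ε δ : ℝ), x ∈ F → 0 < δ → δ ≤ ε → q + ε • (q - x) ∈ F → q + δ • (q - x) ∈ F := by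
    intro x ε δ hx hδ hδε h
    have hε : 0 < ε := lt_of_lt_of_le hδ hδε
    have := hcv hq h (a := 1 - δ / ε) (b := δ / ε)
      (by rw [sub_nonneg, div_le_one hε]; exact hδε) (by positivity) (by ring)
    convert this using 1
    match_scalars <;> field_simp <;> ring
  have hGcv : Convex ℝ G := by
    rintro x ⟨hx, ε, hε, hxe⟩ y ⟨hy, δ, hδ, hye⟩ a b ha hb hab
    refine ⟨hcv hx hy ha hb hab, min ε δ, lt_min hε hδ, ?_⟩
    have h1 := shrink x ε (min ε δ) hx (lt_min hε hδ) (min_le_left _ _) hxe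
    have h2 := shrink y δ (min ε δ) hy (lt_min hε hδ) (min_le_right _ _) hye
    have := hcv h1 h2 ha hb hab
    convert this using 1
    have hb' : b = 1 - a := by linarith
    subst hb'
    module
  have hGex : IsExtreme ℝ F G := by
    refine ⟨fun x hx => hx.1, ?_⟩
    rintro x hx y hy z ⟨hz, ε, hε, hze⟩ ⟨a, b, ha, hb, hab, rfl⟩
    refine ⟨hx, ε * a / (1 + ε * b), by positivity, ?_⟩
    have hpos : 0 < 1 + ε * b := by positivity
    have := hcv hze hy (a := 1 / (1 + ε * b)) (b := ε * b / (1 + ε * b)) (by positivity)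
      (by positivity) (by field_simp)
    convert this using 1
    have hb' : b = 1 - a := by linarith
    subst hb'
    match_scalars <;> field_simp <;> ring
  have hGP : IsExtreme ℝ (convexHull ℝ (W : Set (Euc d))) G := hex.trans hGex
  have hGcl : IsClosed G := by
    rw [face_eq_hull hGP hGcv]
    exact ((W.finite_toSet.subset inter_subset_right).isCompact_convexHull (𝕜 := ℝ)).isClosed
  refine ⟨G, ⟨⟨q, hqG⟩, hGcl, hGcv, hGP⟩, hGex, ?_, q, hqG, ?_⟩
  · intro h; rw [h] at hcG; exact hcG hcF
  · refine ⟨1 - 1 / t0, 1 / t0, ?_, by positivity, by ring, ?_⟩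
    · rw [sub_nonneg, div_le_one ht0p]; exact ht1
    · simp only [q]
      match_scalars <;> field_simp <;> ring

/-- Every point of a face lies in the simplex of a chain of faces. -/
lemma chain_cover {d : ℕ} (W : Finset (Euc d)) (c : Set (Euc d) → Euc d)
    (hc : ∀ F, IsFace (convexHull ℝ (W : Set (Euc d))) F → c F ∈ F) :
    ∀ n : ℕ, ∀ F, IsFace (convexHull ℝ (W : Set (Euc d))) F → faceDim F < n → ∀ p ∈ F,
      ∃ C : Finset (Set (Euc d)),
        (∀ G ∈ C, IsFace (convexHull ℝ (W : Set (Euc d))) G ∧ G ⊆ F) ∧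
        IsChain (· ⊆ ·) (C : Set (Set (Euc d))) ∧ p ∈ convexHull ℝ (c '' C) := by
  intro n
  induction n with
  | zero => intro F _ h; omega
  | succ n ih =>
    intro F hF hdim p hp
    by_cases hpc : p = c F
    · refine ⟨{F}, ?_, ?_, ?_⟩
      · intro G hG; rw [Finset.mem_singleton] at hG; subst hG; exact ⟨hF, Subset.rfl⟩
      · simp
      · simp [hpc]
    · obtain ⟨G, hG, hGF, hne, q, hq, hpq⟩ := exists_smaller_face W F hF (c F) p (hc F hF) hp hpc
      have hlt := faceDim_lt hG.1 hG.2.2.1 hGF hne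
      obtain ⟨C, hC1, hC2, hC3⟩ := ih G hG (by omega) q hq
      refine ⟨insert F C, ?_, ?_, ?_⟩
      · intro H hH
        rcases Finset.mem_insert.1 hH with rfl | hH
        · exact ⟨hF, Subset.rfl⟩
        · exact ⟨(hC1 H hH).1, (hC1 H hH).2.trans hGF.subset⟩
      · rw [Finset.coe_insert]
        refine hC2.insert ?_
        intro H hH _
        right
        exact (hC1 H hH).2.trans hGF.subset
      · have hconv := convex_convexHull ℝ (c '' ((insert F C : Finset (Set (Euc d))) : Set (Set (Euc d))))
        refine hconv.segment_subset ?_ ?_ hpq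
        · exact subset_convexHull ℝ _ ⟨F, by simp, rfl⟩
        · exact convexHull_mono (image_mono (by simp)) hC3

/-! ### Balls and densities -/

lemma hilbertBall_subset {d : ℕ} {P : Set (Euc d)} (hcv : Convex ℝ P) (hcl : IsClosed P)
    (hbd : Bornology.IsBounded P) (h0 : (0 : Euc d) ∈ interior P) (R : ℝ) :
    hilbertBall (interior P) 0 R ⊆ (fun x => (1 - Real.exp (-2 * R)) • x) '' P := by
  rintro q ⟨hqU, hq⟩
  have hP0 : (0 : Euc d) ∈ P := interior_subset h0
  by_cases hq0 : q = 0
  · exact ⟨0, hP0, by simp [hq0]⟩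
  have hq0' : (0 : Euc d) ≠ q := fun h => hq0 h.symm
  rw [hilbertDist, if_neg hq0'] at hq
  simp only [zero_add, sub_zero] at hq
  set T : Set ℝ := {t : ℝ | t • q ∈ interior P} with hT
  have hqn : 0 < ‖q‖ := norm_pos_iff.2 hq0
  obtain ⟨M, hM⟩ := hbd.exists_norm_le
  have hTabs : ∀ t ∈ T, |t| ≤ M / ‖q‖ := by
    intro t ht
    rw [le_div_iff₀ hqn]
    have := hM _ (interior_subset ht)
    rwa [norm_smul] at this
  have hTa : BddAbove T := ⟨M / ‖q‖, fun t ht => (le_abs_self t).trans (hTabs t ht)⟩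
  have hTb : BddBelow T := ⟨-(M / ‖q‖), fun t ht => by
    have := (neg_abs_le t); have := hTabs t ht; linarith⟩
  have hTo : IsOpen T := isOpen_interior.preimage (by fun_prop)
  have h0T : (0 : ℝ) ∈ T := by simp [hT, h0]
  have h1T : (1 : ℝ) ∈ T := by simp [hT, hqU]
  have hb : 1 < sSup T := by
    obtain ⟨ε, hε, hball⟩ := Metric.isOpen_iff.1 hTo 1 h1T
    have : 1 + ε / 2 ∈ T := hball (by
      rw [Metric.mem_ball, Real.dist_eq, add_sub_cancel_left, abs_of_pos (by positivity)]
      linarith)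
    have := le_csSup hTa this
    linarith
  have ha : sInf T < 0 := by
    obtain ⟨ε, hε, hball⟩ := Metric.isOpen_iff.1 hTo 0 h0T
    have : -(ε / 2) ∈ T := hball (by
      rw [Metric.mem_ball, Real.dist_eq, sub_zero, abs_neg, abs_of_pos (by positivity)]
      linarith)
    have := csInf_le hTb this
    linarith
  set a := sInf T
  set b := sSup T
  have hx : 1 ≤ (1 - a) / (-a) := by
    rw [le_div_iff₀ (by linarith)]; linarith
  have hy : 0 < b / (b - 1) := div_pos (by linarith) (by linarith)
  have hlog : Real.log (b / (b - 1)) ≤ 2 * R := by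
    have : Real.log (b / (b - 1)) ≤ Real.log ((1 - a) / (-a) * (b / (b - 1))) := by
      apply Real.log_le_log hy
      nlinarith
    linarith
  have hexp : b / (b - 1) ≤ Real.exp (2 * R) := by
    rwa [Real.log_le_iff_le_exp hy] at hlog
  have hee : Real.exp (-2 * R) * Real.exp (2 * R) = 1 := by
    rw [← Real.exp_add]; simp
  have h1 : b * Real.exp (-2 * R) ≤ b - 1 := by
    rw [div_le_iff₀ (by linarith)] at hexp
    have := mul_le_mul_of_nonneg_left hexp (Real.exp_pos (-2 * R)).le
    rw [← mul_assoc, hee] at this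
    linarith
  have h2 : 1 ≤ b * (1 - Real.exp (-2 * R)) := by linarith
  have hr : 0 < 1 - Real.exp (-2 * R) := by
    by_contra hcon
    have : b * (1 - Real.exp (-2 * R)) ≤ 0 :=
      mul_nonpos_of_nonneg_of_nonpos (by linarith) (not_lt.1 hcon)
    linarith
  have hbq : b • q ∈ P := by
    have hcl' : IsClosed {t : ℝ | t • q ∈ P} := hcl.preimage (by fun_prop)
    have hmem : b ∈ closure T := csSup_mem_closure ⟨1, h1T⟩ hTa
    have hsub : T ⊆ {t : ℝ | t • q ∈ P} := fun t ht => interior_subset (s := P) ht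
    exact closure_minimal hsub hcl' hmem
  set r := 1 - Real.exp (-2 * R)
  refine ⟨r⁻¹ • q, ?_, ?_⟩
  · have hbpos : 0 < b := by linarith
    have := hcv hP0 hbq (a := 1 - r⁻¹ / b) (b := r⁻¹ / b) (by
      rw [sub_nonneg, div_le_one hbpos, inv_le_iff_one_le_mul₀ hr]; exact h2) (by positivity)
      (by ring)
    rw [smul_zero, zero_add, smul_smul, div_mul_cancel₀ _ hbpos.ne'] at this
    exact this
  · simp [smul_smul, hr.ne']

lemma polar_bound {d : ℕ} {P : Set (Euc d)} (hcv : Convex ℝ P)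
    (hbd : Bornology.IsBounded P) {p w y : Euc d} (hp : p ∈ interior P) (h1 : p + w ∈ P)
    (h2 : p - w ∈ P) (hy : y ∈ polarSet (finslerUnitBall (interior P) p)) :
    ⟪w, y⟫ ≤ 2 := by
  by_cases hw : w = 0
  · simp [hw]
  have hv0 : (1 / 2 : ℝ) • w ≠ 0 := by simp [hw]
  have hmem : (1 / 2 : ℝ) • w ∈ finslerUnitBall (interior P) p := by
    obtain ⟨M, hM⟩ := hbd.exists_norm_le
    have key : ∀ u : Euc d, u ≠ 0 → p + u ∈ P →
        1 < sSup {t : ℝ | 0 < t ∧ p + t • ((1 / 2 : ℝ) • u) ∈ interior P} := by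
      intro u hu hpu
      have hun : 0 < ‖u‖ := norm_pos_iff.2 hu
      have hb : BddAbove {t : ℝ | 0 < t ∧ p + t • ((1 / 2 : ℝ) • u) ∈ interior P} := by
        refine ⟨2 * (M + ‖p‖) / ‖u‖, ?_⟩
        rintro t ⟨ht, hmem⟩
        rw [le_div_iff₀ hun]
        have e1 := hM _ (interior_subset hmem)
        have e2 := norm_sub_le (p + t • ((1 / 2 : ℝ) • u)) p
        rw [add_sub_cancel_left, norm_smul, norm_smul, Real.norm_of_nonneg ht.le,
          Real.norm_of_nonneg (by norm_num)] at e2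
        linarith
      have hin : (3 / 2 : ℝ) ∈ {t : ℝ | 0 < t ∧ p + t • ((1 / 2 : ℝ) • u) ∈ interior P} := by
        refine ⟨by norm_num, ?_⟩
        have := hcv.combo_interior_self_mem_interior hp hpu (a := 1 / 4) (b := 3 / 4)
          (by norm_num) (by norm_num) (by norm_num)
        convert this using 1
        module
      have := le_csSup hb hin
      linarith
    have k1 := key w hw h1
    have k2 := key (-w) (by simpa using hw) (by simpa [sub_eq_add_neg] using h2)
    simp only [smul_neg, ← sub_eq_add_neg] at k2
    change finslerNorm _ _ _ < 1
    rw [finslerNorm, if_neg hv0]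
    have e1 : 1 / sSup {t : ℝ | 0 < t ∧ p + t • ((1 / 2 : ℝ) • w) ∈ interior P} < 1 := by
      rw [div_lt_one (by linarith)]; exact k1
    have e2 : 1 / sSup {t : ℝ | 0 < t ∧ p - t • ((1 / 2 : ℝ) • w) ∈ interior P} < 1 := by
      rw [div_lt_one (by linarith)]; exact k2
    linarith
  have := hy _ hmem
  rw [real_inner_smul_left] at this
  linarith

/-- The linear map with columns `e i`. -/
def colMap {d : ℕ} (e : Fin d → Euc d) : Euc d →L[ℝ] Euc d :=
  ∑ i, (EuclideanSpace.proj i : Euc d →L[ℝ] ℝ).smulRight (e i)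

lemma colMap_apply {d : ℕ} (e : Fin d → Euc d) (x : Euc d) :
    colMap e x = ∑ i, x i • e i := by
  simp [colMap]

lemma volume_box {d : ℕ} (s : Fin d → ℝ) :
    volume {y : Euc d | ∀ i, |y i| ≤ s i} = ∏ i, ENNReal.ofReal (2 * s i) := by
  have h : {y : Euc d | ∀ i, |y i| ≤ s i} =
      (MeasurableEquiv.toLp 2 (Fin d → ℝ)).symm ⁻¹' (Set.pi univ fun i => Icc (-(s i)) (s i)) := by
    ext y; simp [abs_le, Pi.le_def, forall_and]
  rw [h, (EuclideanSpace.volume_preserving_symm_measurableEquiv_toLp (Fin d)).measure_preimage_equiv,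
    volume_pi_pi]
  refine Finset.prod_congr rfl fun i _ => ?_
  rw [Real.volume_Icc]
  congr 1
  ring

lemma volume_polar_le {d : ℕ} (e : Fin d → Euc d) (hdet : (colMap e).det ≠ 0) (s : Fin d → ℝ) :
    volume {y : Euc d | ∀ i, |⟪e i, y⟫| ≤ s i} =
      ENNReal.ofReal (|(colMap e).det|⁻¹) * ∏ i, ENNReal.ofReal (2 * s i) := by
  have hE : ∀ (y : Euc d) i, (LinearMap.adjoint (colMap e : Euc d →ₗ[ℝ] Euc d) y) i = ⟪e i, y⟫ := by
    intro y i
    have h1 : (LinearMap.adjoint (colMap e : Euc d →ₗ[ℝ] Euc d) y) i =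
        ⟪EuclideanSpace.single i (1 : ℝ), LinearMap.adjoint (colMap e : Euc d →ₗ[ℝ] Euc d) y⟫ := by
      rw [EuclideanSpace.inner_single_left]; simp
    rw [h1, LinearMap.adjoint_inner_right]
    congr 1
    simp [colMap_apply]
  have hdet' : LinearMap.det (LinearMap.adjoint (colMap e : Euc d →ₗ[ℝ] Euc d)) =
      (colMap e).det := by
    let b := EuclideanSpace.basisFun (Fin d) ℝ
    rw [← LinearMap.det_toMatrix b.toBasis, LinearMap.toMatrix_adjoint b b,
      Matrix.det_conjTranspose, LinearMap.det_toMatrix]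
    rfl
  have hset : {y : Euc d | ∀ i, |⟪e i, y⟫| ≤ s i} =
      (LinearMap.adjoint (colMap e : Euc d →ₗ[ℝ] Euc d)) ⁻¹' {y : Euc d | ∀ i, |y i| ≤ s i} := by
    ext y; simp only [mem_ofPred_eq, mem_preimage, hE]
  rw [hset, Measure.addHaar_preimage_linearMap _ (by rw [hdet']; exact hdet), hdet', volume_box,
    abs_inv]

lemma lintegral_box {d : ℕ} (K δ : ℝ) (hK : 0 ≤ K) (hδ : 0 < δ) (hδ1 : δ ≤ 1) :
    ∫⁻ x in {x : Euc d | ∀ i, x i ∈ Icc δ 1}, ∏ i, ENNReal.ofReal (K / x i) =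
      ENNReal.ofReal ((K * Real.log (1 / δ)) ^ d) := by
  have h : {x : Euc d | ∀ i, x i ∈ Icc δ 1} =
      (MeasurableEquiv.toLp 2 (Fin d → ℝ)).symm ⁻¹' (Set.pi univ fun i => Icc δ 1) := by
    ext y; simp [Pi.le_def, forall_and]
  have hmp := EuclideanSpace.volume_preserving_symm_measurableEquiv_toLp (Fin d)
  have h2 := hmp.setLIntegral_comp_preimage_emb (MeasurableEquiv.measurableEmbedding _)
    (fun x : Fin d → ℝ => ∏ i, ENNReal.ofReal (K / x i)) (Set.pi univ fun i => Icc δ 1)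
  rw [h]
  refine Eq.trans ?_ (h2.trans ?_)
  · rfl
  rw [volume_pi, Measure.restrict_pi_pi]
  have hInt : Integrable (fun t : ℝ => K / t) (volume.restrict (Icc δ 1)) := by
    apply ContinuousOn.integrableOn_Icc
    intro t ht
    exact (continuousAt_const.div continuousAt_id (by have := ht.1; simp; linarith)).continuousWithinAt
  have hpi := Integrable.fintype_prod (ι := Fin d) (f := fun _ t => K / t)
    (μ := fun _ => volume.restrict (Icc δ 1)) (fun _ => hInt)
  have hnn : ∀ᵐ x : Fin d → ℝ ∂(Measure.pi fun _ => volume.restrict (Icc δ 1)),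
      ∀ i, 0 ≤ K / x i := by
    rw [← Measure.restrict_pi_pi]
    refine (ae_restrict_iff' (MeasurableSet.univ_pi fun _ => measurableSet_Icc)).2
      (Eventually.of_forall ?_)
    intro x hx i
    have := (hx i (mem_univ i)).1
    exact div_nonneg hK (by linarith)
  have e1 : ∫⁻ x : Fin d → ℝ, ∏ i, ENNReal.ofReal (K / x i)
        ∂(Measure.pi fun _ => volume.restrict (Icc δ 1)) =
      ∫⁻ x : Fin d → ℝ, ENNReal.ofReal (∏ i, (K / x i))
        ∂(Measure.pi fun _ => volume.restrict (Icc δ 1)) := by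
    apply lintegral_congr_ae
    filter_upwards [hnn] with x hx
    rw [ENNReal.ofReal_prod_of_nonneg (fun i _ => hx i)]
  rw [e1, ← ofReal_integral_eq_lintegral_ofReal hpi]
  · rw [integral_fintype_prod_eq_pow (fun t : ℝ => K / t), Fintype.card_fin]
    congr 2
    rw [integral_Icc_eq_integral_Ioc, ← intervalIntegral.integral_of_le hδ1]
    simp only [div_eq_mul_inv]
    rw [intervalIntegral.integral_const_mul, integral_inv_of_pos hδ one_pos]
    simp
  · filter_upwards [hnn] with x hx
    exact Finset.prod_nonneg (fun i _ => hx i)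

lemma flag_integral {d : ℕ} {P : Set (Euc d)} (hcv : Convex ℝ P)
    (hbd : Bornology.IsBounded P) (c0 : Euc d) (e : Fin d → Euc d) (κ δ : ℝ) (hκ : 0 < κ)
    (hδ : 0 < δ) (hδ1 : δ ≤ 1) (D : Set (Euc d)) (hD : MeasurableSet D)
    (hDb : ∀ x ∈ D, ∀ i, x i ∈ Icc δ 1)
    (hInt : ∀ x ∈ D, c0 + colMap e x ∈ interior P)
    (hmv : ∀ x ∈ D, ∀ i, c0 + colMap e x + (κ * x i) • e i ∈ P ∧
      c0 + colMap e x - (κ * x i) • e i ∈ P) :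
    ∫⁻ p in (fun x => c0 + colMap e x) '' D, volume (polarSet (finslerUnitBall (interior P) p))
      ≤ ENNReal.ofReal ((4 / κ * Real.log (1 / δ)) ^ d) := by
  by_cases hdet : (colMap e).det = 0
  · have : volume ((fun x => c0 + colMap e x) '' D) = 0 := by
      have h1 : (fun x => c0 + colMap e x) '' D = (fun x => c0 + x) '' (colMap e '' D) := by
        rw [image_image]
      rw [h1, image_add_left, measure_preimage_add, Measure.addHaar_image_continuousLinearMap]
      have hdet' : LinearMap.det (colMap e : Euc d →ₗ[ℝ] Euc d) = 0 := hdet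
      rw [hdet']
      simp
    rw [Measure.restrict_eq_zero.2 this]
    simp
  have hinj : Function.Injective (colMap e) := by
    have := (LinearMap.equivOfDetNeZero (colMap e : Euc d →ₗ[ℝ] Euc d) hdet).injective
    exact this
  rw [lintegral_image_eq_lintegral_abs_det_fderiv_mul volume hD
    (f' := fun _ => colMap e)
    (fun x _ => ((colMap e).hasFDerivAt.const_add c0).hasFDerivWithinAt)
    (fun x _ y _ h => hinj (add_left_cancel h))]
  rw [← lintegral_box (4 / κ) δ (by positivity) hδ hδ1]
  refine (setLIntegral_mono' hD ?_).trans (lintegral_mono_set (t := {x : Euc d | ∀ i, x i ∈ Icc δ 1}) hDb)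
  intro x hx
  have hpol : polarSet (finslerUnitBall (interior P) (c0 + colMap e x)) ⊆
      {y : Euc d | ∀ i, |⟪e i, y⟫| ≤ 2 / (κ * x i)} := by
    intro y hy i
    have hxi : 0 < x i := lt_of_lt_of_le hδ (hDb x hx i).1
    have hk : 0 < κ * x i := by positivity
    obtain ⟨m1, m2⟩ := hmv x hx i
    have b1 := polar_bound hcv hbd (hInt x hx) m1 m2 hy
    have b2 := polar_bound hcv hbd (w := -((κ * x i) • e i)) (hInt x hx)
      (by simpa [sub_eq_add_neg] using m2) (by simpa using m1) hy
    rw [inner_neg_left] at b2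
    rw [real_inner_smul_left] at b1 b2
    have habs : |⟪e i, y⟫| * (κ * x i) = |κ * x i * ⟪e i, y⟫| := by
      rw [abs_mul, abs_of_pos hk, mul_comm]
    rw [le_div_iff₀ hk, habs, abs_le]
    constructor <;> linarith
  have h3 := (measure_mono (μ := volume) hpol).trans_eq (volume_polar_le e hdet _)
  have hdpos : 0 < |(colMap e).det| := abs_pos.2 hdet
  calc ENNReal.ofReal |(colMap e).det| * volume (polarSet (finslerUnitBall (interior P) (c0 + colMap e x)))
      ≤ ENNReal.ofReal |(colMap e).det| * (ENNReal.ofReal (|(colMap e).det|⁻¹) *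
        ∏ i, ENNReal.ofReal (2 * (2 / (κ * x i)))) := by gcongr
    _ = ∏ i, ENNReal.ofReal (2 * (2 / (κ * x i))) := by
        rw [← mul_assoc, ← ENNReal.ofReal_mul hdpos.le, mul_inv_cancel₀ hdpos.ne']
        simp
    _ ≤ _ := by
        apply le_of_eq
        apply Finset.prod_congr rfl
        intro i _
        congr 1
        rw [div_div, ← mul_div_assoc]
        norm_num
/-! ### Flag simplices -/

lemma telescope {d : ℕ} (c : Fin (d + 1) → Euc d) (j : Fin (d + 1)) :
    ∑ i : Fin d, (if i.succ ≤ j then (c i.succ - c i.castSucc) else 0) = c j - c 0 := by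
  induction j using Fin.induction with
  | zero =>
    rw [sub_self]
    apply Finset.sum_eq_zero
    intro i _
    rw [if_neg]
    simp
  | succ j ih =>
    have h : ∀ i : Fin d, (if i.succ ≤ j.succ then (c i.succ - c i.castSucc) else 0) =
        (if i.succ ≤ j.castSucc then (c i.succ - c i.castSucc) else 0) +
        (if i = j then (c i.succ - c i.castSucc) else 0) := by
      intro i
      have e1 : i.succ ≤ j.succ ↔ (i : ℕ) ≤ (j : ℕ) := by
        rw [Fin.le_def, Fin.val_succ, Fin.val_succ]; omega
      have e2 : i.succ ≤ j.castSucc ↔ (i : ℕ) + 1 ≤ (j : ℕ) := by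
        rw [Fin.le_def, Fin.val_succ, Fin.val_castSucc]
      have e3 : i = j ↔ (i : ℕ) = j := Fin.ext_iff
      rcases lt_trichotomy (i : ℕ) j with h | h | h
      · rw [if_pos (e1.2 h.le), if_pos (e2.2 h), if_neg (fun h' => by rw [e3] at h'; omega)]
        simp
      · rw [if_pos (e1.2 h.le), if_neg (fun h' => by rw [e2] at h'; omega), if_pos (e3.2 h)]
        simp
      · rw [if_neg (fun h' => by rw [e1] at h'; omega),
          if_neg (fun h' => by rw [e2] at h'; omega), if_neg (fun h' => by rw [e3] at h'; omega)]
        simp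
    rw [Finset.sum_congr rfl (fun i _ => h i), Finset.sum_add_distrib, ih]
    simp

/-- cumulative weights -/
def cumul {d : ℕ} (a : Fin (d + 1) → ℝ) : Euc d :=
  WithLp.toLp 2 (fun i : Fin d => ∑ j, if i.succ ≤ j then a j else 0)

lemma cumul_apply {d : ℕ} (a : Fin (d + 1) → ℝ) (i : Fin d) :
    cumul a i = ∑ j, if i.succ ≤ j then a j else 0 := rfl

lemma cumul_combo {d : ℕ} (c : Fin (d + 1) → Euc d) (a : Fin (d + 1) → ℝ) (ha : ∑ j, a j = 1) :
    c 0 + colMap (fun i : Fin d => c i.succ - c i.castSucc) (cumul a) = ∑ j, a j • c j := by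
  rw [colMap_apply]
  simp only [cumul_apply, Finset.sum_smul]
  rw [Finset.sum_comm]
  have h : ∀ j, ∑ i : Fin d, (if i.succ ≤ j then a j else 0) • (c i.succ - c i.castSucc) =
      a j • (c j - c 0) := by
    intro j
    rw [← telescope c j, Finset.smul_sum]
    refine Finset.sum_congr rfl fun i _ => ?_
    split_ifs <;> simp
  rw [Finset.sum_congr rfl fun j _ => h j]
  simp only [smul_sub, Finset.sum_sub_distrib, ← Finset.sum_smul, ha]
  simp

/-- truncated simplex -/
def truncSimplex {d : ℕ} (c : Fin (d + 1) → Euc d) (δ : ℝ) : Set (Euc d) :=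
  (fun a : Fin (d + 1) → ℝ => ∑ j, a j • c j) ''
    {a | a ∈ stdSimplex ℝ (Fin (d + 1)) ∧ δ ≤ a (Fin.last d)}

lemma simplex_integral {d : ℕ} {P : Set (Euc d)} (hcv : Convex ℝ P)
    (hbd : Bornology.IsBounded P) (h0 : (0 : Euc d) ∈ interior P) (c : Fin (d + 1) → Euc d)
    (hlast : c (Fin.last d) = 0)
    (κ δ : ℝ) (hκ : 0 < κ) (hδ : 0 < δ) (hδ1 : δ ≤ 1) (hcP : ∀ j, c j ∈ P)
    (hmv : ∀ (i : Fin d) (j : Fin (d + 1)), i.succ ≤ j →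
      c j + κ • (c i.succ - c i.castSucc) ∈ P ∧ c j + κ • (c i.castSucc - c i.succ) ∈ P) :
    ∫⁻ p in truncSimplex c δ, volume (polarSet (finslerUnitBall (interior P) p))
      ≤ ENNReal.ofReal ((4 / κ * Real.log (1 / δ)) ^ d) := by
  let L : Set (Fin (d + 1) → ℝ) := {a | a ∈ stdSimplex ℝ (Fin (d + 1)) ∧ δ ≤ a (Fin.last d)}
  have hLc : IsCompact L := by
    have : L = stdSimplex ℝ (Fin (d + 1)) ∩ {a | δ ≤ a (Fin.last d)} := rfl
    rw [this]
    exact (isCompact_stdSimplex ℝ (Fin (d + 1))).inter_right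
      (isClosed_le continuous_const (continuous_apply _))
  have hcum : Continuous (cumul : (Fin (d + 1) → ℝ) → Euc d) := by
    refine (PiLp.continuous_toLp 2 _).comp ?_
    refine continuous_pi fun i => continuous_finsetSum _ fun j _ => ?_
    split_ifs
    · exact continuous_apply j
    · exact continuous_const
  have himg : truncSimplex c δ =
      (fun x => c 0 + colMap (fun i : Fin d => c i.succ - c i.castSucc) x) '' (cumul '' L) := by
    rw [image_image]
    refine image_congr ?_
    intro a ha
    exact (cumul_combo c a ha.1.2).symm
  rw [himg]
  apply flag_integral hcv hbd (c 0) _ κ δ hκ hδ hδ1 (cumul '' L)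
    (hLc.image hcum).isClosed.measurableSet
  · rintro _ ⟨a, ha, rfl⟩ i
    rw [cumul_apply]
    constructor
    · refine ha.2.trans ?_
      have := Finset.single_le_sum (s := Finset.univ)
        (f := fun j => if i.succ ≤ j then a j else 0) (fun j _ => by
          split_ifs
          · exact ha.1.1 j
          · exact le_rfl) (Finset.mem_univ (Fin.last d))
      simpa [Fin.le_last] using this
    · rw [← ha.1.2]
      refine Finset.sum_le_sum fun j _ => ?_
      split_ifs
      · exact le_rfl
      · exact ha.1.1 j
  · rintro _ ⟨a, ha, rfl⟩
    rw [cumul_combo c a ha.1.2]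
    have hl : 0 < a (Fin.last d) := lt_of_lt_of_le hδ ha.2
    let V : Set (Euc d) := (fun z => (∑ j, a j • c j) + z) '' (a (Fin.last d) • interior P)
    have hVo : IsOpen V := by
      have := (isOpen_interior (s := P)).smul₀ hl.ne'
      exact (isOpenMap_add_left _) _ this
    have hVP : V ⊆ P := by
      rintro _ ⟨_, ⟨z, hz, rfl⟩, rfl⟩
      have : (∑ j, a j • c j) + a (Fin.last d) • z =
          ∑ j, a j • (c j + if j = Fin.last d then z else 0) := by
        simp [smul_add, Finset.sum_add_distrib]
      simp only
      rw [this]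
      refine hcv.sum_mem (fun j _ => ha.1.1 j) ha.1.2 ?_
      intro j _
      split_ifs with hj
      · rw [hj, hlast, zero_add]; exact interior_subset hz
      · rw [add_zero]; exact hcP j
    refine interior_maximal hVP hVo ?_
    exact ⟨0, ⟨0, h0, by simp⟩, by simp⟩
  · rintro _ ⟨a, ha, rfl⟩ i
    rw [cumul_combo c a ha.1.2]
    have key : ∀ w : Euc d, (∀ j, i.succ ≤ j → c j + κ • w ∈ P) →
        (∑ j, a j • c j) + (κ * cumul a i) • w ∈ P := by
      intro w hw
      have : (∑ j, a j • c j) + (κ * cumul a i) • w =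
          ∑ j, a j • (c j + if i.succ ≤ j then κ • w else 0) := by
        simp only [smul_add, Finset.sum_add_distrib]
        congr 1
        rw [cumul_apply, Finset.mul_sum, Finset.sum_smul]
        refine Finset.sum_congr rfl fun j _ => ?_
        split_ifs
        · rw [smul_smul, mul_comm]
        · simp
      rw [this]
      refine hcv.sum_mem (fun j _ => ha.1.1 j) ha.1.2 ?_
      intro j _
      split_ifs with hj
      · exact hw j hj
      · rw [add_zero]; exact hcP j
    refine ⟨key _ fun j hj => (hmv i j hj).1, ?_⟩
    have := key (c i.castSucc - c i.succ) fun j hj => (hmv i j hj).2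
    convert this using 1
    rw [← neg_sub (c i.succ), smul_neg, sub_eq_add_neg]

/-! ### Covering -/

lemma null_small {d : ℕ} (hd : 1 ≤ d) (c : Set (Euc d) → Euc d) (C : Finset (Set (Euc d)))
    (hC : C.card ≤ d) : volume (convexHull ℝ (c '' (C : Set (Set (Euc d))))) = 0 := by
  refine measure_mono_null (convexHull_subset_affineSpan _)
    (Measure.addHaar_affineSubspace volume _ ?_)
  intro htop
  have h1 : Module.finrank ℝ (vectorSpan ℝ (c '' (C : Set (Set (Euc d))))) = d := by
    rw [← direction_affineSpan, htop, AffineSubspace.direction_top, finrank_top]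
    simp
  have hne : C.Nonempty := by
    by_contra h
    rw [Finset.not_nonempty_iff_eq_empty] at h
    subst h
    rw [Finset.coe_empty, image_empty, vectorSpan_empty, finrank_bot] at h1
    omega
  have h2 := finrank_vectorSpan_image_finset_le ℝ c C (n := C.card - 1)
    (by have := hne.card_pos; omega)
  rw [Finset.coe_image] at h2
  have := hne.card_pos
  omega

lemma flag_cover {d : ℕ} (W : Finset (Euc d)) (hW : W.Nonempty)
    (hdim : faceDim (convexHull ℝ (W : Set (Euc d))) = d)
    (c : Set (Euc d) → Euc d)
    (hc : ∀ F, IsFace (convexHull ℝ (W : Set (Euc d))) F → c F ∈ F)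
    (p : Euc d) (hp : p ∈ convexHull ℝ (W : Set (Euc d))) :
    (∃ C : Finset (Set (Euc d)), C.card ≤ d ∧
      (∀ G ∈ C, IsFace (convexHull ℝ (W : Set (Euc d))) G) ∧ p ∈ convexHull ℝ (c '' C)) ∨
    ∃ f ∈ flagSet d (convexHull ℝ (W : Set (Euc d))), p ∈ convexHull ℝ (range fun i => c (f i)) := by
  set P := convexHull ℝ (W : Set (Euc d)) with hP
  have hPF : IsFace P P := ⟨by simpa [hP] using hW,
    (W.finite_toSet.isCompact_convexHull (𝕜 := ℝ)).isClosed, convex_convexHull ℝ _, IsExtreme.rfl⟩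
  obtain ⟨C, hC1, hC2, hC3⟩ := chain_cover W c hc (d + 1) P hPF (by omega) p hp
  by_cases hcard : C.card ≤ d
  · exact Or.inl ⟨C, hcard, fun G hG => (hC1 G hG).1, hC3⟩
  right
  have hstrict : ∀ G ∈ C, ∀ H ∈ C, G ⊆ H → G ≠ H → faceDim G < faceDim H := by
    intro G hG H hH hGH hne
    have g := (hC1 G hG).1
    have h := (hC1 H hH).1
    exact faceDim_lt g.1 g.2.2.1 (g.2.2.2.mono h.2.2.2.subset hGH) hne
  have hinj : Set.InjOn faceDim (C : Set (Set (Euc d))) := by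
    intro G hG H hH heq
    by_contra hne
    rcases hC2 hG hH hne with h | h
    · have := hstrict G hG H hH h hne; omega
    · have := hstrict H hH G hG h (Ne.symm hne); omega
  have hle : ∀ G ∈ C, faceDim G ≤ d := by
    intro G _
    have := Submodule.finrank_le (affineSpan ℝ G).direction
    simpa [faceDim] using this
  have himg : C.image faceDim = Finset.range (d + 1) := by
    apply Finset.eq_of_subset_of_card_le
    · intro n hn
      obtain ⟨G, hG, rfl⟩ := Finset.mem_image.1 hn
      have := hle G hG
      simp; omega
    · rw [Finset.card_image_of_injOn hinj, Finset.card_range]; omega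
  have hex : ∀ i : Fin (d + 1), ∃ G ∈ C, faceDim G = i := by
    intro i
    have : (i : ℕ) ∈ C.image faceDim := by
      rw [himg, Finset.mem_range]; exact i.2
    exact Finset.mem_image.1 this
  choose f hf1 hf2 using hex
  refine ⟨f, ⟨fun i => ⟨(hC1 _ (hf1 i)).1, hf2 i⟩, ?_⟩, ?_⟩
  · intro i j hij
    by_cases heq : f i = f j
    · exact heq.subset
    rcases hC2 (hf1 i) (hf1 j) heq with h | h
    · exact h
    · have := hstrict _ (hf1 j) _ (hf1 i) h (Ne.symm heq)
      rw [hf2, hf2] at this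
      have : (i : ℕ) ≤ j := hij
      omega
  · refine convexHull_mono ?_ hC3
    rintro _ ⟨G, hG, rfl⟩
    have hlt : faceDim G < d + 1 := by have := hle G hG; omega
    refine ⟨⟨faceDim G, hlt⟩, ?_⟩
    have : f ⟨faceDim G, hlt⟩ = G := hinj (hf1 _) hG (hf2 _)
    simp [this]

lemma hull_range_subset {d n : ℕ} (c : Fin n → Euc d) {p : Euc d}
    (hp : p ∈ convexHull ℝ (range c)) :
    ∃ a ∈ stdSimplex ℝ (Fin n), ∑ j, a j • c j = p := by
  have hcv : Convex ℝ ((fun a : Fin n → ℝ => ∑ j, a j • c j) '' stdSimplex ℝ (Fin n)) := by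
    have := (convex_stdSimplex ℝ (Fin n)).linear_image (Fintype.linearCombination ℝ c)
    exact this
  have := convexHull_min (s := range c) ?_ hcv hp
  · exact this
  · rintro _ ⟨i, rfl⟩
    refine ⟨Pi.single i 1, single_mem_stdSimplex ℝ i, ?_⟩
    simp [Pi.single_apply]
/-! ### The main estimate -/

lemma flag_piece {d : ℕ} (hd : 1 ≤ d) {P : Set (Euc d)} (hcv : Convex ℝ P)
    (h0 : (0 : Euc d) ∈ interior P) (hPF : IsFace P P) (hdim : faceDim P = d)
    (c : Set (Euc d) → Euc d) (hc : ∀ F, IsFace P F → c F ∈ F) (hcP : c P = 0)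
    (r : ℝ) (hr0 : 0 ≤ r)
    (f : Fin (d + 1) → Set (Euc d)) (hf : f ∈ flagSet d P) :
    f (Fin.last d) = P ∧
    convexHull ℝ (range fun i => c (f i)) ∩ (fun x => r • x) '' P ⊆
      truncSimplex (fun i => c (f i)) (1 - r) := by
  obtain ⟨hf1, hf2⟩ := hf
  have hlast : f (Fin.last d) = P := by
    by_contra hne
    have g := (hf1 (Fin.last d)).1
    have := faceDim_lt g.1 g.2.2.1 g.2.2.2 hne
    rw [(hf1 (Fin.last d)).2, hdim] at this
    simp at this
  refine ⟨hlast, ?_⟩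
  rintro p ⟨hp, x, hx, rfl⟩
  obtain ⟨a, ha, hap⟩ := hull_range_subset _ hp
  refine ⟨a, ⟨ha, ?_⟩, hap⟩
  by_contra hcon
  rw [not_le] at hcon
  -- the facet
  obtain ⟨n, rfl⟩ : ∃ n, d = n + 1 := ⟨d - 1, by omega⟩
  set m : Fin (n + 2) := (Fin.last n).castSucc with hm
  have hG := hf1 m
  have hGne : f m ≠ P := by
    intro h
    have h2 := hG.2
    rw [h, hdim] at h2
    simp [hm] at h2
  have h0G : (0 : Euc (n + 1)) ∉ f m := by
    intro h0m
    apply hGne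
    refine Subset.antisymm hG.1.2.2.2.subset ?_
    intro z hz
    have hev : ∀ᶠ t : ℝ in 𝓝 0, t • z ∈ interior P := by
      have hcont : Continuous fun t : ℝ => t • z := by fun_prop
      apply hcont.continuousAt.eventually_mem
      simpa using isOpen_interior.mem_nhds h0
    obtain ⟨ε, hε, hball⟩ := Metric.eventually_nhds_iff.1 hev
    have hmem : (-(ε / 2)) • z ∈ P := by
      refine interior_subset (hball ?_)
      rw [Real.dist_eq, sub_zero, abs_neg, abs_of_pos (by positivity)]; linarith
    refine hG.1.2.2.2.left_mem_of_mem_openSegment hz hmem h0m ?_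
    refine ⟨(ε/2)/(1+ε/2), 1/(1+ε/2), by positivity, by positivity, by field_simp; ring, ?_⟩
    match_scalars
    field_simp
    ring
  have hsum : ∑ i : Fin (n + 1), a i.castSucc = 1 - a (Fin.last (n + 1)) := by
    have := ha.2
    rw [Fin.sum_univ_castSucc] at this
    linarith
  set s := 1 - a (Fin.last (n + 1)) with hs
  have hspos : r < s := by linarith
  have hs0 : 0 < s := by linarith
  -- the point of the facet
  set q : Euc (n + 1) := ∑ i : Fin (n + 1), (a i.castSucc / s) • c (f i.castSucc) with hq
  have hqG : q ∈ f m := by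
    refine hG.1.2.2.1.sum_mem (fun i _ => div_nonneg (ha.1 _) hs0.le) ?_ ?_
    · rw [← Finset.sum_div, hsum, div_self hs0.ne']
    · intro i _
      apply hf2 i.castSucc m
      · rw [hm, Fin.castSucc_le_castSucc_iff]; exact Fin.le_last i
      · exact hc _ (hf1 _).1
  have hsq : s • q = r • x := by
    have hap' : ∑ j, a j • c (f j) = r • x := hap
    rw [← hap', Fin.sum_univ_castSucc, hlast, hcP, smul_zero, add_zero, hq, Finset.smul_sum]
    refine Finset.sum_congr rfl fun i _ => ?_
    rw [smul_smul, mul_div_cancel₀ _ hs0.ne']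
  have hqe : q = (r / s) • x := by
    rw [div_eq_inv_mul, mul_smul, ← hsq, smul_smul, inv_mul_cancel₀ hs0.ne', one_smul]
  rcases hr0.eq_or_lt with hr | hr
  · apply h0G
    rw [← hr, zero_div, zero_smul] at hqe
    rw [← hqe]; exact hqG
  · apply h0G
    refine hG.1.2.2.2.left_mem_of_mem_openSegment (interior_subset h0) hx hqG ?_
    refine ⟨1 - r / s, r / s, ?_, by positivity, by ring, ?_⟩
    · rw [sub_pos, div_lt_one hs0]; exact hspos
    · rw [smul_zero, zero_add, hqe]

lemma htVol_le_aux {d : ℕ} (hd : 1 ≤ d) {l : ℝ} (hl0 : 0 < l) (κ : ℝ) (hκ : 0 < κ)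
    (hκ1 : κ ≤ 1 / (d + 2)) (hκ2 : κ ≤ l / 2)
    (W : Finset (Euc d)) (P : Set (Euc d)) (hPW : P = convexHull ℝ (W : Set (Euc d)))
    (hW : W.Nonempty) (hdim : faceDim P = d)
    (hlP : l • Metric.closedBall (0 : Euc d) 1 ⊆ P) (hP1 : P ⊆ Metric.closedBall (0 : Euc d) 1)
    (R : ℝ) (hR : 0 ≤ R) (A : Set (Euc d))
    (hA : A ⊆ (fun x => (1 - Real.exp (-2 * R)) • x) '' P) :
    ∫⁻ p in A, volume (polarSet (finslerUnitBall (interior P) p)) ≤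
      ((flagSet d P).ncard : ℝ≥0∞) * ENNReal.ofReal ((4 / κ * (2 * R)) ^ d) := by
  have hcv : Convex ℝ P := by rw [hPW]; exact convex_convexHull ℝ _
  have hcp : IsCompact P := by
    rw [hPW]; exact W.finite_toSet.isCompact_convexHull (𝕜 := ℝ)
  have hbd := hcp.isBounded
  have hballP : ∀ x : Euc d, ‖x‖ ≤ l → x ∈ P := by
    intro x hx
    apply hlP
    refine ⟨l⁻¹ • x, ?_, ?_⟩
    · rw [mem_closedBall_zero_iff, norm_smul, norm_inv, Real.norm_of_nonneg hl0.le,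
        inv_mul_le_iff₀ hl0]
      simpa using hx
    · simp [smul_smul, hl0.ne']
  have h0 : (0 : Euc d) ∈ interior P := by
    rw [mem_interior]
    refine ⟨Metric.ball 0 l, ?_, Metric.isOpen_ball, Metric.mem_ball_self hl0⟩
    intro x hx
    exact hballP x (mem_ball_zero_iff.1 hx).le
  have hPF : IsFace P P := ⟨⟨0, interior_subset h0⟩, hcp.isClosed, hcv, IsExtreme.rfl⟩
  have hfaceC : ∀ F, IsFace P F → IsCompact F := fun F hF =>
    hcp.of_isClosed_subset hF.2.1 hF.2.2.2.subset
  -- centers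
  have hcex : ∀ F : Set (Euc d), ∃ z : Euc d, (F = P → z = 0) ∧ (IsFace P F → z ∈ F ∧
      ∀ x ∈ F, ∀ y ∈ F, z + κ • (x - y) ∈ F) := by
    intro F
    by_cases hFP : F = P
    · subst hFP
      refine ⟨0, fun _ => rfl, fun _ => ⟨interior_subset h0, fun x hx y hy => ?_⟩⟩
      apply hballP
      rw [zero_add, norm_smul, Real.norm_of_nonneg hκ.le]
      have h1 := mem_closedBall_zero_iff.1 (hP1 hx)
      have h2 := mem_closedBall_zero_iff.1 (hP1 hy)
      have h3 : ‖x - y‖ ≤ 2 := (norm_sub_le x y).trans (by linarith)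
      calc κ * ‖x - y‖ ≤ κ * 2 := by gcongr
        _ ≤ l := by linarith
    · by_cases hF : IsFace P F
      · obtain ⟨z, hz, h⟩ := exists_center F hF.1 (hfaceC F hF) hF.2.2.1
        exact ⟨z, fun h => absurd h hFP, fun _ => ⟨hz, h κ hκ.le hκ1⟩⟩
      · exact ⟨0, fun h => absurd h hFP, fun h => absurd h hF⟩
  choose c hcP hcF using hcex
  have hc : ∀ F, IsFace P F → c F ∈ F := fun F hF => (hcF F hF).1
  have hFfin : {F : Set (Euc d) | IsFace P F}.Finite := by rw [hPW]; exact faces_finite W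
  have hflfin : (flagSet d P).Finite := by
    refine (Set.Finite.pi (t := fun _ : Fin (d + 1) => {F : Set (Euc d) | IsFace P F})
      (fun _ => hFfin)).subset ?_
    intro f hf i _
    exact (hf.1 i).1
  set r := 1 - Real.exp (-2 * R) with hr
  have hr0 : 0 ≤ r := by
    have : Real.exp (-2 * R) ≤ 1 := Real.exp_le_one_iff.2 (by linarith)
    linarith
  have hδ : 1 - r = Real.exp (-2 * R) := by rw [hr]; ring
  have hδ0 : 0 < 1 - r := by rw [hδ]; exact Real.exp_pos _
  have hrP : (fun x => r • x) '' P ⊆ P := by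
    rintro _ ⟨x, hx, rfl⟩
    have := hcv (interior_subset h0) hx hδ0.le hr0 (by ring)
    simpa using this
  -- null set
  let CC : Set (Finset (Set (Euc d))) := {C | C.card ≤ d ∧ ∀ G ∈ C, IsFace P G}
  have hCCfin : CC.Finite := by
    refine (Finset.finite_toSet hFfin.toFinset.powerset).subset ?_
    rintro C ⟨-, hC⟩
    simp only [Finset.coe_powerset, mem_preimage, mem_powerset_iff]
    intro G hG
    simpa using hC G hG
  let N : Set (Euc d) := ⋃ C ∈ CC, convexHull ℝ (c '' (C : Set (Set (Euc d))))
  have hN : volume N = 0 := by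
    refine (measure_biUnion_null_iff hCCfin.countable).2 ?_
    rintro C ⟨hC, -⟩
    exact null_small hd c C hC
  haveI : Finite (flagSet d P) := hflfin
  haveI : Fintype (flagSet d P) := Fintype.ofFinite _
  have hcov : A ⊆ N ∪ ⋃ f : flagSet d P, truncSimplex (fun i => c (f.1 i)) (1 - r) := by
    intro p hp
    have hpr := hA hp
    have hpP : p ∈ convexHull ℝ (W : Set (Euc d)) := by rw [← hPW]; exact hrP hpr
    subst hPW
    rcases flag_cover W hW hdim c hc p hpP with ⟨C, h1, h2, h3⟩ | ⟨f, hf, hpf⟩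
    · left
      exact mem_biUnion (show C ∈ CC from ⟨h1, h2⟩) h3
    · right
      exact mem_iUnion.2 ⟨⟨f, hf⟩,
        (flag_piece hd hcv h0 hPF hdim c hc (hcP _ rfl) r hr0 f hf).2 ⟨hpf, hpr⟩⟩
  have hpiece : ∀ f : flagSet d P, ∫⁻ p in truncSimplex (fun i => c (f.1 i)) (1 - r),
      volume (polarSet (finslerUnitBall (interior P) p)) ≤
        ENNReal.ofReal ((4 / κ * (2 * R)) ^ d) := by
    rintro ⟨f, hf⟩
    have hlast := (flag_piece hd hcv h0 hPF hdim c hc (hcP _ rfl) r hr0 f hf).1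
    have hlog : Real.log (1 / (1 - r)) = 2 * R := by
      rw [hδ, one_div, Real.log_inv, Real.log_exp]; ring
    rw [← hlog]
    obtain ⟨hf1, hf2⟩ := hf
    apply simplex_integral hcv hbd h0 _ _ κ (1 - r) hκ hδ0 (by linarith)
    · intro j
      exact (hf1 j).1.2.2.2.subset (hc _ (hf1 j).1)
    · intro i j hij
      have hF := (hf1 j).1
      have m1 : c (f i.succ) ∈ f j := hf2 _ _ hij (hc _ (hf1 _).1)
      have m2 : c (f i.castSucc) ∈ f j :=
        hf2 _ _ ((Fin.castSucc_lt_succ (i := i)).le.trans hij) (hc _ (hf1 _).1)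
      exact ⟨hF.2.2.2.subset ((hcF _ hF).2 _ m1 _ m2), hF.2.2.2.subset ((hcF _ hF).2 _ m2 _ m1)⟩
    · simp only [hlast]
      exact hcP _ rfl
  calc ∫⁻ p in A, volume (polarSet (finslerUnitBall (interior P) p))
      ≤ ∫⁻ p in N ∪ ⋃ f : flagSet d P, truncSimplex (fun i => c (f.1 i)) (1 - r),
          volume (polarSet (finslerUnitBall (interior P) p)) := lintegral_mono_set hcov
    _ ≤ (∫⁻ p in N, volume (polarSet (finslerUnitBall (interior P) p))) +
        ∫⁻ p in ⋃ f : flagSet d P, truncSimplex (fun i => c (f.1 i)) (1 - r),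
          volume (polarSet (finslerUnitBall (interior P) p)) := lintegral_union_le _ _ _
    _ = ∫⁻ p in ⋃ f : flagSet d P, truncSimplex (fun i => c (f.1 i)) (1 - r),
          volume (polarSet (finslerUnitBall (interior P) p)) := by
        rw [Measure.restrict_eq_zero.2 hN]; simp
    _ ≤ ∑' f : flagSet d P, ∫⁻ p in truncSimplex (fun i => c (f.1 i)) (1 - r),
          volume (polarSet (finslerUnitBall (interior P) p)) := lintegral_iUnion_le _ _
    _ ≤ ∑' f : flagSet d P, ENNReal.ofReal ((4 / κ * (2 * R)) ^ d) := ENNReal.tsum_le_tsum hpiece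
    _ = _ := by
        rw [tsum_fintype, Finset.sum_const, nsmul_eq_mul, Finset.card_univ,
          ← Nat.card_eq_fintype_card]
        rfl

/-- uniform polynomial bound on the Holmes–Thompson volume of Hilbert balls
and asymptotic balls of a polytope in terms of its number of maximal flags. -/
theorem htVol_ball_le (d : ℕ) (hd : 1 ≤ d) (l : ℝ) (hl0 : 0 < l) (hl1 : l ≤ 1) :
    ∃ p : Polynomial ℝ, p.natDegree = d ∧
      ∀ (W : Finset (Euc d)) (P : Set (Euc d)), P = convexHull ℝ (W : Set (Euc d)) →
        W.Nonempty → faceDim P = d →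
        l • Metric.closedBall (0 : Euc d) 1 ⊆ P → P ⊆ Metric.closedBall (0 : Euc d) 1 →
        ∀ R : ℝ, 0 ≤ R →
          htVol (interior P) (hilbertBall (interior P) 0 R)
            ≤ ENNReal.ofReal (p.eval R * ((flagSet d P).ncard : ℝ)) ∧
          htVol (interior P) (asympBall (interior P) 0 R)
            ≤ ENNReal.ofReal (p.eval R * ((flagSet d P).ncard : ℝ)) := by
  have hd2 : (0 : ℝ) < d + 2 := by positivity
  set κ : ℝ := min (1 / (d + 2)) (l / 2) with hκdef
  have hκ : 0 < κ := lt_min (by positivity) (by positivity)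
  set ω : ℝ≥0∞ := volume (Metric.ball (0 : Euc d) 1) with hω
  have hω0 : ω ≠ 0 := (Metric.measure_ball_pos volume 0 one_pos).ne'
  have hω1 : ω ≠ ∞ := measure_ball_lt_top.ne
  have hωr : 0 < ω.toReal := ENNReal.toReal_pos hω0 hω1
  set K : ℝ := (4 / κ * 2) ^ d / ω.toReal with hK
  have hK0 : 0 < K := by positivity
  refine ⟨Polynomial.C K * Polynomial.X ^ d, Polynomial.natDegree_C_mul_X_pow d K hK0.ne', ?_⟩
  intro W P hPW hW hdim hlP hP1 R hR
  have main : ∀ A : Set (Euc d), A ⊆ (fun x => (1 - Real.exp (-2 * R)) • x) '' P →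
      htVol (interior P) A ≤ ENNReal.ofReal ((Polynomial.C K * Polynomial.X ^ d).eval R *
        ((flagSet d P).ncard : ℝ)) := by
    intro A hA
    have h1 := htVol_le_aux hd hl0 κ hκ (min_le_left _ _) (min_le_right _ _) W P hPW hW hdim
      hlP hP1 R hR A hA
    rw [htVol]
    simp only [div_eq_mul_inv]
    rw [← hω, lintegral_mul_const' _ _ (ENNReal.inv_ne_top.2 hω0)]
    refine (mul_le_mul_left h1 _).trans (le_of_eq ?_)
    have e1 : ω⁻¹ = ENNReal.ofReal (ω.toReal⁻¹) := by
      rw [ENNReal.ofReal_inv_of_pos hωr, ENNReal.ofReal_toReal hω1]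
    have e2 : ((flagSet d P).ncard : ℝ≥0∞) = ENNReal.ofReal ((flagSet d P).ncard : ℝ) := by
      simp
    rw [e1, e2, ← ENNReal.ofReal_mul (by positivity), ← ENNReal.ofReal_mul (by positivity)]
    congr 1
    simp only [Polynomial.eval_mul, Polynomial.eval_C, Polynomial.eval_pow, Polynomial.eval_X, hK]
    rw [← mul_assoc (4 / κ), mul_pow (4 / κ * 2)]
    ring
  have hcv : Convex ℝ P := by rw [hPW]; exact convex_convexHull ℝ _
  have hcp : IsCompact P := by
    rw [hPW]; exact W.finite_toSet.isCompact_convexHull (𝕜 := ℝ)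
  have h0 : (0 : Euc d) ∈ interior P := by
    rw [mem_interior]
    refine ⟨Metric.ball 0 l, ?_, Metric.isOpen_ball, Metric.mem_ball_self hl0⟩
    intro x hx
    apply hlP
    refine ⟨l⁻¹ • x, ?_, ?_⟩
    · rw [mem_closedBall_zero_iff, norm_smul, norm_inv, Real.norm_of_nonneg hl0.le,
        inv_mul_le_iff₀ hl0]
      simpa using (mem_ball_zero_iff.1 hx).le
    · simp [smul_smul, hl0.ne']
  constructor
  · exact main _ (hilbertBall_subset hcv hcp.isClosed hcp.isBounded h0 R)
  · apply main
    unfold asympBall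
    split_ifs
    · rintro _ ⟨u, hu, rfl⟩
      exact ⟨u, interior_subset hu, by simp⟩
    · exact empty_subset _

end
end

section
/- Let Ω ⊆ ℝ^d be a closed convex set containing the closed Euclidean ball of radius l > 0 centered at the origin, let x₁ be a point of the boundary ∂Ω, let t ≥ 1, and set x₂ := t·x₁. If the Euclidean distance from x₂ to Ω is at most ε ≥ 0, then t ≤ 1 + ε/l. -/
open Filter Set MeasureTheory Metric
open scoped ENNReal Topology Pointwise RealInnerProductSpace

noncomputable section
open scoped Classical

/-- if `Ω` is closed convex containing `closedBall 0 l`, `x₁ ∈ ∂Ω`, `t ≥ 1`,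
and the distance from `t • x₁` to `Ω` is at most `ε`, then `t ≤ 1 + ε/l`. -/
theorem ray_scaling_bound (d : ℕ) (Ω : Set (Euc d))
    (hcl : IsClosed Ω) (hconv : Convex ℝ Ω)
    (l : ℝ) (hl : 0 < l) (hb : Metric.closedBall (0 : Euc d) l ⊆ Ω)
    (x₁ : Euc d) (hx₁ : x₁ ∈ frontier Ω) (t : ℝ) (ht : 1 ≤ t)
    (ε : ℝ) (hε : 0 ≤ ε) (hdist : Metric.infDist (t • x₁) Ω ≤ ε) :
    t ≤ 1 + ε / l := by
  by_contra hcon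
  push Not at hcon
  have h1 : ε < (t - 1) * l := by
    rw [← div_lt_iff₀ hl]; linarith
  have ht1 : 0 < t - 1 := by
    have : 0 ≤ ε / l := div_nonneg hε hl.le
    linarith
  have ht0 : 0 < t := by linarith
  have hne : Ω.Nonempty := ⟨0, hb (Metric.mem_closedBall_self hl.le)⟩
  obtain ⟨w, hw, hwd⟩ := (Metric.infDist_lt_iff hne).1 (lt_of_le_of_lt hdist h1)
  have hv : (t - 1)⁻¹ • (t • x₁ - w) ∈ interior Ω := by
    apply interior_maximal (Metric.ball_subset_closedBall.trans hb) Metric.isOpen_ball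
    rw [mem_ball_zero_iff, norm_smul, Real.norm_of_nonneg (inv_nonneg.2 ht1.le),
      ← dist_eq_norm, inv_mul_lt_iff₀ ht1]
    exact hwd
  have hmem := hconv.combo_self_interior_mem_interior hw hv
    (a := t⁻¹) (b := t⁻¹ * (t - 1)) (inv_nonneg.2 ht0.le) (by positivity)
    (by field_simp; ring)
  have heq : t⁻¹ • w + (t⁻¹ * (t - 1)) • (t - 1)⁻¹ • (t • x₁ - w) = x₁ := by
    rw [smul_smul, mul_assoc, mul_inv_cancel₀ ht1.ne', mul_one, ← smul_add,
      add_sub_cancel, smul_smul, inv_mul_cancel₀ ht0.ne', one_smul]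
  rw [heq] at hmem
  exact hx₁.2 hmem

end
end

section
/- Let D ⊆ ℝ^d be a convex body, and let x := (Leb(D))⁻¹ · ∫_D y dLeb(y) be its centroid. Let p ∈ ∂D and q ∈ D be such that x lies on the closed segment [p,q]. Then |p − x| ≥ |p − q|/(d+1), where |·| denotes the Euclidean norm. -/
open Filter Set MeasureTheory Metric
open scoped ENNReal Topology Pointwise RealInnerProductSpace

noncomputable section
open scoped Classical

theorem csb_key (d : ℕ) (D : Set (Euc d))
    (hcomp : IsCompact D) (hconv : Convex ℝ D) (f : Euc d →L[ℝ] ℝ) (c : ℝ)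
    (hf : ∀ y ∈ D, f y ≤ c) (q : Euc d) (hq : q ∈ D) :
    (c - f q) * (volume D).toReal ≤ ((d : ℝ) + 1) * ∫ y in D, (c - f y) := by
  set K : Euc d → ℝ := D.indicator (fun y => c - f y) with hK
  set I : ℝ := ∫ y in D, (c - f y) with hI
  have hmeas : MeasurableSet D := hcomp.measurableSet
  have hKI : ∫ y, K y = I := integral_indicator hmeas
  have hcont : Continuous (fun y => c - f y) := by fun_prop
  have hint1 : IntegrableOn (fun y => c - f y) D := hcont.continuousOn.integrableOn_compact hcomp
  have hKint : Integrable K := hint1.integrable_indicator hmeas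
  have hfin : IsFiniteMeasure (volume.restrict D) :=
    ⟨by simpa using hcomp.measure_lt_top⟩
  have step : ∀ s : ℝ, 0 < s → s < 1 →
      s ^ d * ((c - f q) * (volume D).toReal) ≤ (∑ i ∈ Finset.range (d + 1), s ^ i) * I := by
    intro s hs0 hs1
    have e1 : ∫ z, K (s • z + (q - s • q)) = (s ^ d)⁻¹ * I := by
      rw [Measure.integral_comp_smul volume (fun z => K (z + (q - s • q))) s,
        integral_add_right_eq_self, hKI]
      simp [abs_of_pos hs0]
    have e2 : ∫ z in D, ((1 - s) * (c - f q) + s * (c - f z))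
        = (1 - s) * ((c - f q) * (volume D).toReal) + s * I := by
      rw [integral_add (integrable_const _) (hint1.const_mul s), integral_const_mul, integral_const_mul, ← hI,
        setIntegral_const, smul_eq_mul, Measure.real]
      ring
    have hle : ∫ z in D, ((1 - s) * (c - f q) + s * (c - f z))
        ≤ ∫ z, K (s • z + (q - s • q)) := by
      rw [← integral_indicator hmeas]
      apply integral_mono
      · exact IntegrableOn.integrable_indicator
          (Integrable.add (integrable_const _) (hint1.const_mul s)) hmeas
      · exact (hKint.comp_add_right (q - s • q)).comp_smul hs0.ne'
      · intro z
        by_cases hz : z ∈ D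
        · have hm : s • z + (q - s • q) ∈ D := by
            have := hconv hz hq hs0.le (by linarith : (0:ℝ) ≤ 1 - s) (by ring)
            rwa [sub_smul, one_smul] at this
          simp only [hK, indicator_of_mem hz, indicator_of_mem hm, map_add, map_sub, map_smul,
            smul_eq_mul]
          apply le_of_eq; ring
        · rw [indicator_of_notMem hz]
          exact indicator_nonneg (fun y hy => by linarith [hf y hy]) _
    rw [e1, e2] at hle
    have hsd : 0 < s ^ d := by positivity
    have h2 : s ^ d * ((1 - s) * ((c - f q) * (volume D).toReal) + s * I) ≤ I := by
      have := mul_le_mul_of_nonneg_left hle hsd.le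
      rwa [mul_inv_cancel_left₀ hsd.ne'] at this
    have h3 := mul_neg_geom_sum s (d + 1)
    have h4 : (1 - s) * (s ^ d * ((c - f q) * (volume D).toReal)) ≤
        (1 - s) * ((∑ i ∈ Finset.range (d + 1), s ^ i) * I) := by
      rw [← mul_assoc (1 - s) (Finset.sum _ _), h3, pow_succ]
      linarith
    exact le_of_mul_le_mul_left h4 (by linarith)
  have t1 : Tendsto (fun s : ℝ => s ^ d * ((c - f q) * (volume D).toReal)) (𝓝[<] 1)
      (𝓝 ((c - f q) * (volume D).toReal)) := by
    have : Continuous (fun s : ℝ => s ^ d * ((c - f q) * (volume D).toReal)) := by fun_prop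
    simpa using (this.tendsto 1).mono_left nhdsWithin_le_nhds
  have t2 : Tendsto (fun s : ℝ => (∑ i ∈ Finset.range (d + 1), s ^ i) * I) (𝓝[<] 1)
      (𝓝 (((d : ℝ) + 1) * I)) := by
    have : Continuous (fun s : ℝ => (∑ i ∈ Finset.range (d + 1), s ^ i) * I) := by fun_prop
    simpa using (this.tendsto 1).mono_left nhdsWithin_le_nhds
  refine le_of_tendsto_of_tendsto t1 t2 ?_
  filter_upwards [Ioo_mem_nhdsLT (zero_lt_one (α := ℝ))] with s hs
  exact step s hs.1 hs.2

/-- if the centroid `x` of a convex body `D` lies on a segment `[p, q]` with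
`p ∈ ∂D` and `q ∈ D`, then `|p - x| ≥ |p - q|/(d+1)`. -/
theorem centroid_segment_bound (d : ℕ) (D : Set (Euc d))
    (hcomp : IsCompact D) (hconv : Convex ℝ D) (hint : (interior D).Nonempty)
    (x : Euc d) (hx : x = ((volume D).toReal)⁻¹ • ∫ y in D, y)
    (p q : Euc d) (hp : p ∈ frontier D) (hq : q ∈ D) (hseg : x ∈ segment ℝ p q) :
    ‖p - q‖ / ((d : ℝ) + 1) ≤ ‖p - x‖ := by
  have hpI : p ∉ interior D := hp.2
  obtain ⟨f, hfI⟩ := geometric_hahn_banach_open_point hconv.interior isOpen_interior hpI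
  have hf : ∀ y ∈ D, f y ≤ f p := by
    intro y hy
    have h1 : y ∈ closure (interior D) := by
      rw [hconv.closure_interior_eq_closure_of_nonempty_interior hint]
      exact subset_closure hy
    exact closure_minimal (fun z hz => (hfI z hz).le)
      (isClosed_le f.continuous continuous_const) h1
  have hV : 0 < (volume D).toReal :=
    ENNReal.toReal_pos ((Measure.measure_pos_of_nonempty_interior _ hint).ne') hcomp.measure_lt_top.ne
  have hfin : IsFiniteMeasure (volume.restrict D) :=
    ⟨by simpa using hcomp.measure_lt_top⟩
  have hid : IntegrableOn (fun y : Euc d => y) D :=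
    continuous_id.continuousOn.integrableOn_compact hcomp
  have hfint : IntegrableOn (fun y : Euc d => f y) D :=
    f.continuous.continuousOn.integrableOn_compact hcomp
  have hIx : ∫ y in D, (f p - f y) = (volume D).toReal * (f p - f x) := by
    rw [integral_sub (integrable_const _) hfint, f.integral_comp_comm hid, hx, map_smul,
      smul_eq_mul, mul_sub, mul_inv_cancel_left₀ hV.ne']
    simp [Measure.real]
  have key : ∀ z ∈ D, f p - f z ≤ ((d : ℝ) + 1) * (f p - f x) := by
    intro z hz
    have h := csb_key d D hcomp hconv f (f p) hf z hz
    rw [hIx] at h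
    refine le_of_mul_le_mul_right ?_ hV
    linarith
  have hd : (0 : ℝ) < (d : ℝ) + 1 := by positivity
  have hxpos : 0 < f p - f x := by
    obtain ⟨z, hz⟩ := hint
    have h1 := key z (interior_subset hz)
    have h2 := hfI z hz
    exact pos_of_mul_pos_right (lt_of_lt_of_le (by linarith) h1) hd.le
  obtain ⟨a, t, ha, ht, hat, hxe⟩ := hseg
  have ha' : a = 1 - t := by linarith
  have hpx : p - x = t • (p - q) := by
    rw [← hxe, ha']; module
  have hfx : f p - f x = t * (f p - f q) := by
    rw [← map_sub, hpx, map_smul, smul_eq_mul, map_sub]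
  have hqpos : 0 < f p - f q := by
    rw [hfx] at hxpos
    exact pos_of_mul_pos_right hxpos ht
  have h1 : 1 ≤ ((d : ℝ) + 1) * t := by
    have := key q hq
    rw [hfx] at this
    refine le_of_mul_le_mul_right ?_ hqpos
    linarith
  rw [hpx, norm_smul, Real.norm_of_nonneg ht, div_le_iff₀ hd]
  nlinarith [norm_nonneg (p - q)]

end
end

section
/- There exists a constant C' > 0 depending only on the dimension d with the following property. Let Ω ⊆ ℝ^d be a convex body with (1/d)·B̄(0,1) ⊆ Ω ⊆ B̄(0,1), where B̄(0,1) is the closed Euclidean unit ball. Let H be a closed halfspace with 0 ∉ H and int H ∩ Ω ≠ ∅, let h be its bounding hyperplane, let ε := sup{dist(z,h) : z ∈ Ω ∩ H} be the width of the cap Ω ∩ H, and let x be the centroid of the base D := Ω ∩ h with respect to the (d−1)-dimensional Lebesgue measure on h. Then the unique point x' where the ray from the origin through x meets ∂Ω satisfies |x − x'| ≥ C'·ε. -/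
open Filter Set MeasureTheory Metric
open scoped ENNReal Topology Pointwise RealInnerProductSpace

noncomputable section
open scoped Classical

lemma base_measure (n : ℕ) (Ω : Set (Euc (n+1))) (hc : IsCompact Ω) (u : Euc (n+1)) (hu : u ≠ 0)
    (c : ℝ) (y0 : Euc (n+1)) (hy : y0 ∈ interior Ω) (hy' : ⟪u, y0⟫ = c) :
    (Measure.hausdorffMeasure (n : ℝ)) (Ω ∩ {y : Euc (n+1) | ⟪u, y⟫ = c}) ≠ 0 ∧
    (Measure.hausdorffMeasure (n : ℝ)) (Ω ∩ {y : Euc (n+1) | ⟪u, y⟫ = c}) ≠ ⊤ := by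
  have hfact : Fact (Module.finrank ℝ (Euc (n+1)) = n + 1) := ⟨by simp⟩
  have hfin : Module.finrank ℝ (ℝ ∙ u)ᗮ = n := Submodule.finrank_orthogonal_span_singleton hu
  let φ : (ℝ ∙ u)ᗮ → Euc (n+1) := fun w => y0 + (w : Euc (n+1))
  have hφ : Isometry φ := by
    apply Isometry.of_dist_eq
    intro a b
    simp [φ, Subtype.dist_eq]
  have himg : Ω ∩ {y : Euc (n+1) | ⟪u, y⟫ = c} = φ '' (φ ⁻¹' Ω) := by
    ext y
    constructor
    · rintro ⟨h1, h2⟩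
      have hm : y - y0 ∈ (ℝ ∙ u)ᗮ := by
        rw [Submodule.mem_orthogonal_singleton_iff_inner_right, inner_sub_right, h2, hy', sub_self]
      refine ⟨⟨y - y0, hm⟩, ?_, ?_⟩
      · simpa [φ] using h1
      · simp [φ]
    · rintro ⟨w, hw, rfl⟩
      refine ⟨hw, ?_⟩
      have := (Submodule.mem_orthogonal_singleton_iff_inner_right).1 w.2
      simp only [φ, mem_setOf_eq, inner_add_right, hy', this, add_zero]
  have hH : (Measure.hausdorffMeasure (n : ℝ) : Measure (ℝ ∙ u)ᗮ).IsAddHaarMeasure := by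
    have := MeasureTheory.isAddHaarMeasure_hausdorffMeasure (E := (ℝ ∙ u)ᗮ)
    rwa [hfin] at this
  rw [himg, hφ.hausdorffMeasure_image (Or.inl (by positivity))]
  constructor
  · have ho : IsOpen (φ ⁻¹' interior Ω) := isOpen_interior.preimage hφ.continuous
    have hp := ho.measure_pos (Measure.hausdorffMeasure (n : ℝ)) ⟨0, by simpa [φ] using hy⟩
    exact (hp.trans_le (measure_mono (preimage_mono interior_subset))).ne'
  · have : IsCompact (φ ⁻¹' Ω) := hφ.isClosedEmbedding.isCompact_preimage hc
    exact this.measure_lt_top.ne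

lemma avg_bound (n : ℕ) (D : Set (Euc (n+1))) (hD : IsCompact D) (hconv : Convex ℝ D)
    (h0 : (Measure.hausdorffMeasure (n : ℝ)) D ≠ 0)
    (h1 : (Measure.hausdorffMeasure (n : ℝ)) D ≠ ⊤)
    (f : Euc (n+1) →L[ℝ] ℝ) (M : ℝ) (hM : ∀ y ∈ D, f y ≤ M) (p : Euc (n+1)) (hp : p ∈ D) :
    (1/2 : ℝ)^(n+1) * (M - f p) ≤
      M - f (((Measure.hausdorffMeasure (n : ℝ)) D).toReal⁻¹ •
        ∫ y in D, y ∂(Measure.hausdorffMeasure (n : ℝ))) := by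
  set μ : Measure (Euc (n+1)) := Measure.hausdorffMeasure (n : ℝ) with hμ
  set m := (μ D).toReal with hm
  have hmpos : 0 < m := ENNReal.toReal_pos h0 h1
  have hint : IntegrableOn (fun y : Euc (n+1) => y) D μ := by
    obtain ⟨R, hR⟩ := hD.isBounded.exists_norm_le
    exact Measure.integrableOn_of_bounded h1 aestronglyMeasurable_id
      ((ae_restrict_iff' hD.measurableSet).2 (ae_of_all _ hR))
  have hintf : IntegrableOn (fun y : Euc (n+1) => f y) D μ := f.integrable_comp hint
  have hintc : IntegrableOn (fun _ : Euc (n+1) => M) D μ := integrableOn_const h1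
  have hintg : IntegrableOn (fun y : Euc (n+1) => M - f y) D μ := hintc.sub hintf
  have hfI : f (∫ y in D, y ∂μ) = ∫ y in D, f y ∂μ := (f.integral_comp_comm hint).symm
  have hI : ∫ y in D, (M - f y) ∂μ = m * M - f (∫ y in D, y ∂μ) := by
    rw [integral_sub hintc hintf, hfI, setIntegral_const, smul_eq_mul]; rfl
  let K : Set (Euc (n+1)) := AffineMap.homothety p (1/2 : ℝ) '' D
  have hKm : μ K = ENNReal.ofReal ((1/2 : ℝ)^n) * μ D := by
    have := hausdorffMeasure_homothety_image (d := (n:ℝ)) (by positivity) p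
      (c := (1/2 : ℝ)) (by norm_num) D
    simp only [K, hμ]
    rw [this, ENNReal.smul_def, smul_eq_mul]
    congr 1
    rw [ENNReal.ofReal, NNReal.rpow_natCast]
    congr 1
    ext
    rw [Real.coe_toNNReal _ (by positivity)]
    simp
  have hKr : μ.real K = (1/2 : ℝ)^n * m := by
    rw [measureReal_def, hKm, ENNReal.toReal_mul, ENNReal.toReal_ofReal (by positivity)]
  have hKfin : μ K ≠ ⊤ := by
    rw [hKm]; exact ENNReal.mul_ne_top ENNReal.ofReal_ne_top h1
  have hKeq : ∀ y, AffineMap.homothety p (1/2 : ℝ) y = (1/2 : ℝ) • p + (1/2 : ℝ) • y := by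
    intro y
    rw [AffineMap.homothety_apply, vsub_eq_sub, vadd_eq_add]
    module
  have hKD : K ⊆ D := by
    rintro _ ⟨y, hy, rfl⟩
    rw [hKeq]
    exact hconv hp hy (by norm_num) (by norm_num) (by norm_num)
  have hKc : IsCompact K := hD.image (by
    have : (AffineMap.homothety p (1/2 : ℝ) : Euc (n+1) → Euc (n+1)) =
      fun y => (1/2 : ℝ) • p + (1/2 : ℝ) • y := funext hKeq
    rw [this]; fun_prop)
  have hlow : ((1/2 : ℝ)^n * m) * ((M - f p)/2) ≤ ∫ y in D, (M - f y) ∂μ := by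
    calc ((1/2 : ℝ)^n * m) * ((M - f p)/2) = ∫ y in K, ((M - f p)/2) ∂μ := by
          rw [setIntegral_const, hKr, smul_eq_mul]
      _ ≤ ∫ y in K, (M - f y) ∂μ := by
          apply setIntegral_mono_on (integrableOn_const hKfin) (hintg.mono_set hKD)
            hKc.measurableSet
          rintro _ ⟨y, hy, rfl⟩
          rw [hKeq]
          have := hM y hy
          simp only [map_add, map_smul, smul_eq_mul]
          linarith
      _ ≤ ∫ y in D, (M - f y) ∂μ := by
          apply setIntegral_mono_set hintg
          · exact (ae_restrict_iff' hD.measurableSet).2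
              (ae_of_all _ fun y hy => sub_nonneg.2 (hM y hy))
          · exact hKD.eventuallyLE
  rw [hI] at hlow
  rw [map_smul, smul_eq_mul]
  have h2 : m * (M - m⁻¹ * f (∫ y in D, y ∂μ)) = m * M - f (∫ y in D, y ∂μ) := by
    field_simp
  rw [← h2] at hlow
  refine le_of_mul_le_mul_left (le_trans (le_of_eq ?_) hlow) hmpos
  ring

/-- for a convex body in canonical position, the distance from the centroid of
the base of a cap of width `ε` to the point where the ray from the origin through it meets
the boundary is at least `C'·ε`, with `C' > 0` depending only on `d`. -/
theorem centroid_ray_distance (d : ℕ) :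
    ∃ C' > (0 : ℝ), ∀ Ω : Set (Euc d),
      IsCompact Ω → Convex ℝ Ω → (interior Ω).Nonempty →
      ((d : ℝ)⁻¹) • Metric.closedBall (0 : Euc d) 1 ⊆ Ω →
      Ω ⊆ Metric.closedBall (0 : Euc d) 1 →
      ∀ (u : Euc d) (cst : ℝ), u ≠ 0 →
        (0 : Euc d) ∉ {y : Euc d | cst ≤ ⟪u, y⟫} →
        ({y : Euc d | cst < ⟪u, y⟫} ∩ Ω).Nonempty →
        ∀ ε : ℝ,
          ε = sSup ((fun z => Metric.infDist z {y : Euc d | ⟪u, y⟫ = cst}) ''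
              (Ω ∩ {y : Euc d | cst ≤ ⟪u, y⟫})) →
        ∀ x : Euc d,
          x = ((MeasureTheory.Measure.hausdorffMeasure ((d : ℝ) - 1))
                  (Ω ∩ {y : Euc d | ⟪u, y⟫ = cst})).toReal⁻¹ •
                ∫ y in (Ω ∩ {y : Euc d | ⟪u, y⟫ = cst}), y
                  ∂(MeasureTheory.Measure.hausdorffMeasure ((d : ℝ) - 1)) →
        ∀ x' : Euc d, x' ∈ frontier Ω → (∃ t : ℝ, 0 ≤ t ∧ x' = t • x) →
          C' * ε ≤ ‖x - x'‖ := by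
  rcases d with _ | n
  · refine ⟨1, one_pos, ?_⟩
    intro Ω _ _ _ _ _ u _ hu
    exact absurd (Subsingleton.elim u 0) hu
  refine ⟨((n+1 : ℕ) : ℝ)⁻¹ * (1/2)^(n+1), by positivity, ?_⟩
  intro Ω hc hconv _ hin hout u c hu h0 hne ε hε x hx x' hx' ht
  have hn1 : (((n+1 : ℕ) : ℝ) - 1) = (n : ℝ) := by push_cast; ring
  rw [hn1] at hx
  have hNpos : (0:ℝ) < ((n+1 : ℕ) : ℝ)⁻¹ := by positivity
  have hball : ball (0 : Euc (n+1)) (((n+1 : ℕ) : ℝ)⁻¹) ⊆ interior Ω := by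
    apply interior_maximal _ isOpen_ball
    refine subset_trans ?_ hin
    rw [smul_unitClosedBall, Real.norm_of_nonneg hNpos.le]
    exact ball_subset_closedBall
  have h0i : (0 : Euc (n+1)) ∈ interior Ω := hball (mem_ball_self hNpos)
  have hcpos : 0 < c := by simpa using h0
  have hx'ni : x' ∉ interior Ω := hx'.2
  have hx'n : ((n+1 : ℕ) : ℝ)⁻¹ ≤ ‖x'‖ := by
    by_contra hlt
    exact hx'ni (hball (by simpa using not_le.1 hlt))
  have hscale : ∀ z ∈ Ω, c ≤ ⟪u, z⟫ → (c / ⟪u, z⟫) • z ∈ Ω ∩ {y : Euc (n+1) | ⟪u, y⟫ = c} := by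
    intro z hz hcz
    have hzp : 0 < ⟪u, z⟫ := hcpos.trans_le hcz
    refine ⟨hconv.smul_mem_of_zero_mem (interior_subset h0i) hz
      ⟨by positivity, (div_le_one hzp).2 hcz⟩, ?_⟩
    simp only [mem_setOf_eq, inner_smul_right]
    field_simp
  obtain ⟨z0, hz0, hz0Ω⟩ := hne
  have hz0p : 0 < ⟪u, z0⟫ := hcpos.trans hz0
  have hy0 : (c / ⟪u, z0⟫) • z0 ∈ interior Ω := by
    have := hconv.combo_interior_self_mem_interior h0i hz0Ω
      (a := 1 - c / ⟪u, z0⟫) (b := c / ⟪u, z0⟫)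
      (sub_pos.2 ((div_lt_one hz0p).2 hz0)) (by positivity) (by ring)
    simpa using this
  obtain ⟨hm0, hm1⟩ := base_measure n Ω hc u hu c _ hy0 (hscale z0 hz0Ω (le_of_lt hz0)).2
  obtain ⟨f, hf⟩ := geometric_hahn_banach_open_point hconv.interior isOpen_interior hx'ni
  have hMpos : 0 < f x' := by simpa using hf 0 h0i
  have hfΩ : ∀ y ∈ Ω, f y ≤ f x' := by
    intro y hy
    have hcl : y ∈ closure (interior Ω) := by
      rw [hconv.closure_interior_eq_closure_of_nonempty_interior ⟨0, h0i⟩]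
      exact subset_closure hy
    exact closure_minimal (fun a ha => (hf a ha).le)
      (isClosed_le f.continuous continuous_const) hcl
  have hhc : IsClosed {y : Euc (n+1) | ⟪u, y⟫ = c} := isClosed_eq (by fun_prop) continuous_const
  have hhconv : Convex ℝ {y : Euc (n+1) | ⟪u, y⟫ = c} :=
    convex_hyperplane (innerSL ℝ u).toLinearMap.isLinear c
  obtain ⟨t, ht0, htx⟩ := ht
  have htpos : 0 < t := by
    rcases ht0.eq_or_lt with h | h
    · rw [htx, ← h] at hMpos; simp at hMpos
    · exact h
  have hxx : x = t⁻¹ • x' := by rw [htx, smul_smul, inv_mul_cancel₀ htpos.ne', one_smul]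
  have hfx : f x = t⁻¹ * f x' := by rw [hxx]; simp
  rw [hε]
  rw [← le_div_iff₀' (by positivity)]
  apply csSup_le
  · exact ⟨_, z0, ⟨hz0Ω, (le_of_lt hz0 : c ≤ ⟪u, z0⟫)⟩, rfl⟩
  rintro _ ⟨z, ⟨hz, hcz⟩, rfl⟩
  rw [le_div_iff₀' (by positivity)]
  have hzp : 0 < ⟪u, z⟫ := hcpos.trans_le hcz
  have hp := hscale z hz hcz
  set s := c / ⟪u, z⟫ with hs
  have hs1 : s ≤ 1 := (div_le_one hzp).2 hcz
  have hspos : 0 ≤ s := by positivity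
  have hdist : infDist z {y : Euc (n+1) | ⟪u, y⟫ = c} ≤ 1 - s := by
    refine (infDist_le_dist_of_mem hp.2).trans ?_
    have hzn : ‖z‖ ≤ 1 := by simpa using hout hz
    have : z - s • z = (1 - s) • z := by module
    rw [dist_eq_norm, this, norm_smul, Real.norm_of_nonneg (sub_nonneg.2 hs1)]
    exact mul_le_of_le_one_right (sub_nonneg.2 hs1) hzn
  have hav := avg_bound n _ (hc.inter_right hhc) (hconv.inter hhconv) hm0 hm1 f (f x')
    (fun y hy => hfΩ y hy.1) _ hp
  rw [← hx, hfx, map_smul, smul_eq_mul] at hav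
  have hfz := hfΩ z hz
  have hkey : (1/2 : ℝ)^(n+1) * (1 - s) ≤ 1 - t⁻¹ := by
    refine le_of_mul_le_mul_right ?_ hMpos
    calc (1/2 : ℝ)^(n+1) * (1 - s) * f x' = (1/2 : ℝ)^(n+1) * (f x' - s * f x') := by ring
      _ ≤ (1/2 : ℝ)^(n+1) * (f x' - s * f z) := by gcongr
      _ ≤ _ := hav
      _ = _ := by ring
  have hnorm : (1 - t⁻¹) * ‖x'‖ ≤ ‖x - x'‖ := by
    have : x - x' = -((1 - t⁻¹) • x') := by rw [hxx]; module
    rw [this, norm_neg, norm_smul]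
    gcongr
    exact le_abs_self _
  have hk0 : 0 ≤ (1/2 : ℝ)^(n+1) * (1 - s) := mul_nonneg (by positivity) (sub_nonneg.2 hs1)
  calc ((n+1 : ℕ) : ℝ)⁻¹ * (1/2)^(n+1) * infDist z {y : Euc (n+1) | ⟪u, y⟫ = c}
      ≤ ((n+1 : ℕ) : ℝ)⁻¹ * (1/2)^(n+1) * (1 - s) := by gcongr
    _ = ((1/2 : ℝ)^(n+1) * (1 - s)) * ((n+1 : ℕ) : ℝ)⁻¹ := by ring
    _ ≤ (1 - t⁻¹) * ‖x'‖ := mul_le_mul hkey hx'n hNpos.le (hk0.trans hkey)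
    _ ≤ _ := hnorm

end
end

section
/- Let Ω ⊆ ℝ^d be a convex body and let x ∈ int Ω. Then the Macbeath region satisfies B_{int Ω}(x, (1/2)·log(6/5)) ⊆ M'(x) ⊆ B_{int Ω}(x, (1/2)·log(3/2)). -/
open Filter Set MeasureTheory Metric
open scoped ENNReal Topology Pointwise RealInnerProductSpace

noncomputable section
open scoped Classical

theorem mvh_abs_le {d : ℕ} {Ω : Set (Euc d)} (hcomp : IsCompact Ω) (x v : Euc d) (hv : v ≠ 0) :
    ∃ C : ℝ, ∀ t : ℝ, x + t • v ∈ Ω → |t| ≤ C := by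
  obtain ⟨C, hC⟩ := hcomp.isBounded.exists_norm_le
  have hv' : 0 < ‖v‖ := norm_pos_iff.mpr hv
  refine ⟨(C + ‖x‖) / ‖v‖, fun t ht => ?_⟩
  rw [le_div_iff₀ hv']
  have h1 := hC _ ht
  have h2 : ‖t • v‖ ≤ ‖x + t • v‖ + ‖x‖ := by
    have := norm_sub_le (x + t • v) x
    simpa using this
  rw [norm_smul, Real.norm_eq_abs] at h2
  linarith

theorem mvh_mem {d : ℕ} {Ω : Set (Euc d)} {x v : Euc d} {a : ℝ} (hconv : Convex ℝ Ω)
    (hx : x ∈ Ω) (ha : x + a • v ∈ Ω) (r : ℝ) (h0 : 0 ≤ r) (h1 : r ≤ 1) :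
    x + (r * a) • v ∈ Ω := by
  have h := hconv hx ha (sub_nonneg.mpr h1) h0 (by ring)
  convert h using 1
  module

theorem mvh_mem_int {d : ℕ} {Ω : Set (Euc d)} {x v : Euc d} {a : ℝ} (hconv : Convex ℝ Ω)
    (hx : x ∈ interior Ω) (ha : x + a • v ∈ Ω) (r : ℝ) (h0 : 0 ≤ r) (h1 : r < 1) :
    x + (r * a) • v ∈ interior Ω := by
  have h := hconv.combo_interior_self_mem_interior hx ha (sub_pos.mpr h1) h0 (by ring)
  convert h using 1
  module

theorem mvh_mem_macbeath {d : ℕ} (Ω : Set (Euc d)) (x q : Euc d) :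
    q ∈ macbeath Ω x ↔ x + (5 : ℝ) • (q - x) ∈ Ω ∧ x + (-5 : ℝ) • (q - x) ∈ Ω := by
  unfold macbeath
  constructor
  · rintro ⟨v, ⟨⟨_, ⟨w, hw, rfl⟩, h1⟩, ⟨_, ⟨w', hw', rfl⟩, h2⟩⟩, rfl⟩
    simp only at h1 h2
    constructor
    · convert hw using 1
      simp only [← h1]
      module
    · convert hw' using 1
      simp only [← h2]
      module
  · rintro ⟨h1, h2⟩
    refine ⟨q - x, ⟨⟨_, ⟨_, h1, rfl⟩, ?_⟩, ⟨_, ⟨_, h2, rfl⟩, ?_⟩⟩, ?_⟩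
    · simp only
      module
    · simp only
      module
    · simp

/-- the Macbeath region `M'(x)` is squeezed between Hilbert balls of radii
`(1/2)·log(6/5)` and `(1/2)·log(3/2)`. -/
theorem macbeath_vs_hilbert (d : ℕ) (Ω : Set (Euc d))
    (hcomp : IsCompact Ω) (hconv : Convex ℝ Ω) (hint : (interior Ω).Nonempty)
    (x : Euc d) (hx : x ∈ interior Ω) :
    hilbertBall (interior Ω) x ((1 / 2) * Real.log (6 / 5)) ⊆ macbeath Ω x ∧
    macbeath Ω x ⊆ hilbertBall (interior Ω) x ((1 / 2) * Real.log (3 / 2)) := by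
  have hx' : x ∈ Ω := interior_subset hx
  constructor
  · rintro q ⟨hq, hd⟩
    rw [mvh_mem_macbeath]
    by_cases hxq : x = q
    · subst hxq
      simpa using hx'
    have hv : q - x ≠ 0 := sub_ne_zero.mpr (Ne.symm hxq)
    obtain ⟨C, hC⟩ := mvh_abs_le hcomp x (q - x) hv
    unfold hilbertDist at hd
    rw [if_neg hxq] at hd
    set S : Set ℝ := {t : ℝ | x + t • (q - x) ∈ interior Ω} with hS
    have hba : BddAbove S := ⟨C, fun t ht => (abs_le.mp (hC t (interior_subset ht))).2⟩
    have hbb : BddBelow S := ⟨-C, fun t ht => (abs_le.mp (hC t (interior_subset ht))).1⟩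
    have hcont : Continuous fun t : ℝ => x + t • (q - x) := by fun_prop
    have hopen : IsOpen S := isOpen_interior.preimage hcont
    have h0 : (0 : ℝ) ∈ S := by simpa [hS] using hx
    have h1 : (1 : ℝ) ∈ S := by simpa [hS] using hq
    have hT : IsClosed {t : ℝ | x + t • (q - x) ∈ Ω} := hcomp.isClosed.preimage hcont
    have hST : closure S ⊆ {t : ℝ | x + t • (q - x) ∈ Ω} :=
      closure_minimal (fun t ht => interior_subset (s := Ω) ht) hT
    have hi : x + sInf S • (q - x) ∈ Ω := hST (csInf_mem_closure ⟨0, h0⟩ hbb)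
    have hs : x + sSup S • (q - x) ∈ Ω := hST (csSup_mem_closure ⟨0, h0⟩ hba)
    have hineg : sInf S < 0 := by
      obtain ⟨e, he, hb⟩ := Metric.isOpen_iff.mp hopen 0 h0
      have : -(e / 2) ∈ S := hb (by simp [abs_of_pos he]; exact he)
      have := csInf_le hbb this
      linarith
    have hsgt : 1 < sSup S := by
      obtain ⟨e, he, hb⟩ := Metric.isOpen_iff.mp hopen 1 h1
      have : 1 + e / 2 ∈ S := hb (by simp [abs_of_pos he]; exact he)
      have := le_csSup hba this
      linarith
    generalize sInf S = i at *
    generalize sSup S = s at *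
    have hs1 : 0 < s - 1 := by linarith
    have hi1 : 0 < -i := by linarith
    have hA : 0 < (1 - i) / (-i) := div_pos (by linarith) hi1
    have hB : 0 < s / (s - 1) := div_pos (by linarith) hs1
    have hlog := (Real.log_le_log_iff (mul_pos hA hB) (by norm_num : (0:ℝ) < 6 / 5)).mp
      (by linarith)
    rw [div_mul_div_comm, div_le_div_iff₀ (mul_pos hi1 hs1) (by norm_num)] at hlog
    have hs5 : 6 ≤ s := by nlinarith
    have hi5 : i ≤ -5 := by nlinarith
    constructor
    · have := mvh_mem hconv hx' hs (5 / s) (by positivity) (by rw [div_le_one] <;> linarith)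
      rwa [div_mul_cancel₀ _ (by linarith)] at this
    · have := mvh_mem hconv hx' hi (-5 / i) (div_nonneg_of_nonpos (by norm_num) hineg.le)
        (by rw [div_le_one_of_neg hineg]; exact hi5)
      rwa [div_mul_cancel₀ _ hineg.ne] at this
  · intro q hq
    rw [mvh_mem_macbeath] at hq
    obtain ⟨hp, hm⟩ := hq
    have hqU : q ∈ interior Ω := by
      have := mvh_mem_int hconv hx hp (1 / 5) (by norm_num) (by norm_num)
      norm_num at this
      exact this
    refine ⟨hqU, ?_⟩
    unfold hilbertDist
    by_cases hxq : x = q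
    · rw [if_pos hxq]
      have := Real.log_pos (by norm_num : (1:ℝ) < 3 / 2)
      positivity
    rw [if_neg hxq]
    have hv : q - x ≠ 0 := sub_ne_zero.mpr (Ne.symm hxq)
    obtain ⟨C, hC⟩ := mvh_abs_le hcomp x (q - x) hv
    set S : Set ℝ := {t : ℝ | x + t • (q - x) ∈ interior Ω} with hS
    have hba : BddAbove S := ⟨C, fun t ht => (abs_le.mp (hC t (interior_subset ht))).2⟩
    have hbb : BddBelow S := ⟨-C, fun t ht => (abs_le.mp (hC t (interior_subset ht))).1⟩
    have hs5 : 5 ≤ sSup S := by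
      by_contra! hlt
      have h0 : 0 ≤ sSup S := le_csSup hba (by simpa [hS] using hx)
      have hm' : ((sSup S + 5) / 10) * 5 ∈ S :=
        mvh_mem_int hconv hx hp _ (by linarith) (by linarith)
      have := le_csSup hba hm'
      linarith
    have hi5 : sInf S ≤ -5 := by
      by_contra! hlt
      have h0 : sInf S ≤ 0 := csInf_le hbb (by simpa [hS] using hx)
      have hm' : ((-sInf S + 5) / 10) * (-5) ∈ S :=
        mvh_mem_int hconv hx hm _ (by linarith) (by linarith)
      have := csInf_le hbb hm'
      linarith
    generalize sInf S = i at *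
    generalize sSup S = s at *
    have hs1 : 0 < s - 1 := by linarith
    have hi1 : 0 < -i := by linarith
    have hA : 0 < (1 - i) / (-i) := div_pos (by linarith) hi1
    have hB : 0 < s / (s - 1) := div_pos (by linarith) hs1
    have hA' : (1 - i) / (-i) ≤ 6 / 5 := by
      rw [div_le_div_iff₀ hi1 (by norm_num)]; linarith
    have hB' : s / (s - 1) ≤ 5 / 4 := by
      rw [div_le_div_iff₀ hs1 (by norm_num)]; linarith
    have hlog := Real.log_le_log (mul_pos hA hB)
      ((mul_le_mul hA' hB' hB.le (by norm_num)).trans (by norm_num : (6 / 5 * (5 / 4) : ℝ) ≤ 3 / 2))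
    linarith

end
end

section
/- Let Ω ⊆ ℝ^d be a convex body, let x ∈ int Ω, and let y ∈ int Ω with y ≠ x. Then y belongs to the Macbeath region M'(x) if and only if d_F(x,y) ≤ log(5/4) and d_F(y,x) ≤ log(6/5). -/
open Filter Set MeasureTheory Metric
open scoped ENNReal Topology Pointwise RealInnerProductSpace

noncomputable section
open scoped Classical

theorem funkDist_le_log_iff_mem {d : ℕ} (Ω : Set (Euc d))
    (hcomp : IsCompact Ω) (hconv : Convex ℝ Ω)
    (p : Euc d) (hp : p ∈ interior Ω) (q : Euc d) (hq : q ∈ interior Ω) (hne : p ≠ q)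
    (c : ℝ) (hc : 1 < c) :
    funkDist Ω p q ≤ Real.log (c / (c - 1)) ↔ p + c • (q - p) ∈ Ω := by
  have hcont : Continuous (fun t : ℝ => p + t • (q - p)) := by fun_prop
  set T : Set ℝ := {t : ℝ | p + t • (q - p) ∈ Ω} with hT
  have hclosed : IsClosed T := hcomp.isClosed.preimage hcont
  have h0 : (0 : ℝ) ∈ T := by
    simpa [hT] using interior_subset hp
  have hpos : 0 < ‖q - p‖ := norm_pos_iff.mpr (sub_ne_zero.mpr hne.symm)
  have hbdd : BddAbove T := by
    obtain ⟨R, hR⟩ := hcomp.isBounded.exists_norm_le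
    refine ⟨(R + ‖p‖) / ‖q - p‖, fun t ht => ?_⟩
    rw [le_div_iff₀ hpos]
    have h1 : ‖p + t • (q - p)‖ ≤ R := hR _ ht
    have h2 : ‖t • (q - p)‖ ≤ ‖p + t • (q - p)‖ + ‖p‖ := by
      have := norm_sub_le (p + t • (q - p)) p
      simpa using this
    rw [norm_smul] at h2
    have h3 : t * ‖q - p‖ ≤ ‖t‖ * ‖q - p‖ :=
      mul_le_mul_of_nonneg_right (Real.le_norm_self t) hpos.le
    linarith
  have hsT : sSup T ∈ T := hclosed.csSup_mem ⟨0, h0⟩ hbdd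
  have hs1 : 1 < sSup T := by
    have hn : ∀ᶠ t in 𝓝 (1 : ℝ), p + t • (q - p) ∈ interior Ω := by
      apply hcont.continuousAt.eventually_mem
      apply isOpen_interior.mem_nhds
      simpa using hq
    obtain ⟨ε, hε, hb⟩ := Metric.eventually_nhds_iff.mp hn
    have hm : (1 + ε / 2) ∈ T := by
      show p + (1 + ε / 2) • (q - p) ∈ Ω
      apply interior_subset
      apply hb
      rw [Real.dist_eq, add_sub_cancel_left, abs_of_pos (by linarith)]
      linarith
    have := le_csSup hbdd hm
    linarith
  have key : p + c • (q - p) ∈ Ω ↔ c ≤ sSup T := by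
    constructor
    · intro h
      exact le_csSup hbdd h
    · intro h
      have hs0 : 0 < sSup T := by linarith
      have hmem := hconv.add_smul_sub_mem (interior_subset hp) hsT
        (t := c / sSup T) ⟨by positivity, (div_le_one hs0).mpr h⟩
      rw [add_sub_cancel_left, smul_smul, div_mul_cancel₀ _ hs0.ne'] at hmem
      exact hmem
  rw [key, funkDist, if_neg hne, ← hT]
  have a1 : 0 < sSup T - 1 := by linarith
  have a2 : 0 < c - 1 := by linarith
  rw [Real.log_le_log_iff (div_pos (by linarith) a1) (div_pos (by linarith) a2),
    div_le_div_iff₀ a1 a2]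
  constructor <;> intro h <;> linarith

theorem mem_macbeath_iff_mem {d : ℕ} (Ω : Set (Euc d)) (x y : Euc d) :
    y ∈ macbeath Ω x ↔ x + (5 : ℝ) • (y - x) ∈ Ω ∧ y + (6 : ℝ) • (x - y) ∈ Ω := by
  unfold macbeath
  constructor
  · rintro ⟨v, ⟨⟨_, ⟨a, ha, rfl⟩, h1⟩, ⟨_, ⟨b, hb, rfl⟩, h2⟩⟩, rfl⟩
    simp only at h1 h2 ⊢
    constructor
    · convert ha using 1
      rw [← h1]; module
    · convert hb using 1
      rw [← h2]; module
  · rintro ⟨h1, h2⟩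
    refine ⟨y - x, ⟨⟨_, ⟨_, h1, rfl⟩, ?_⟩, ⟨_, ⟨_, h2, rfl⟩, ?_⟩⟩, ?_⟩
    · simp only; module
    · simp only; module
    · simp

/-- a point `y ≠ x` of `int Ω` lies in the Macbeath region `M'(x)` if and only
if `d_F(x,y) ≤ log(5/4)` and `d_F(y,x) ≤ log(6/5)`. -/
theorem mem_macbeath_iff_funk (d : ℕ) (Ω : Set (Euc d))
    (hcomp : IsCompact Ω) (hconv : Convex ℝ Ω) (hint : (interior Ω).Nonempty)
    (x : Euc d) (hx : x ∈ interior Ω) (y : Euc d) (hy : y ∈ interior Ω) (hne : y ≠ x) :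
    y ∈ macbeath Ω x ↔
      funkDist Ω x y ≤ Real.log (5 / 4) ∧ funkDist Ω y x ≤ Real.log (6 / 5) := by
  rw [mem_macbeath_iff_mem,
    ← funkDist_le_log_iff_mem Ω hcomp hconv x hx y hy hne.symm 5 (by norm_num),
    ← funkDist_le_log_iff_mem Ω hcomp hconv y hy x hx hne 6 (by norm_num)]
  norm_num

end
end
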